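/- arXiv:1203.2592 — 8 statements merged into one kernel-verified Lean document; each statement's English description precedes it below -/
import Mathlib

section
/- Let q ∈ ℂ with q ≠ 0 and q² ≠ 1, and let n ≥ 3. There is a unique ℂ-algebra homomorphism Φ₂ : H_n(q²) → Tl_n(q) with Φ₂(T_i) = −qU_i − 1 for all 1 ≤ i ≤ n−1. Moreover Φ₂ is surjective and its kernel is the two-sided ideal of H_n(q²) generated by the element T_1T_2T_1 + T_1T_2 + T_2T_1 + T_1 + T_2 + 1. -/
noncomputable section

namespace Statement7

/-- The generator `U_i` of the Temperley–Lieb algebra in the free algebra on `U_1, …, U_{n-1}`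
(0-indexed). -/
def UT (q : ℂ) (n : ℕ) (i : Fin (n - 1)) : FreeAlgebra ℂ (Fin (n - 1)) :=
  FreeAlgebra.ι ℂ i

/-- The defining relations of the Temperley–Lieb algebra `Tl_n(q)`. -/
inductive TLRel (q : ℂ) (n : ℕ) :
    FreeAlgebra ℂ (Fin (n - 1)) → FreeAlgebra ℂ (Fin (n - 1)) → Prop
  | Usq (i : Fin (n - 1)) : TLRel q n (UT q n i * UT q n i) ((-(q + q⁻¹)) • UT q n i)
  | UUU (i j : Fin (n - 1)) (h : i.val + 1 = j.val ∨ j.val + 1 = i.val) :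
      TLRel q n (UT q n i * UT q n j * UT q n i) (UT q n i)
  | Ucomm (i j : Fin (n - 1)) (h : i.val + 1 < j.val ∨ j.val + 1 < i.val) :
      TLRel q n (UT q n i * UT q n j) (UT q n j * UT q n i)

/-- The Temperley–Lieb algebra `Tl_n(q)`. -/
abbrev TL (q : ℂ) (n : ℕ) := RingQuot (TLRel q n)

/-- The image of `U_i` in the Temperley–Lieb algebra. -/
def UmkTL (q : ℂ) (n : ℕ) (i : Fin (n - 1)) : TL q n :=
  RingQuot.mkAlgHom ℂ (TLRel q n) (UT q n i)

/-- The generator `T_i` of the type `A` Hecke algebra in the free algebra (0-indexed). -/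
def TA (q0 : ℂ) (n : ℕ) (i : Fin (n - 1)) : FreeAlgebra ℂ (Fin (n - 1)) :=
  FreeAlgebra.ι ℂ i

/-- The defining relations of the Hecke algebra `H_n(q₀)` of type `A_{n-1}`. -/
inductive HARel (q0 : ℂ) (n : ℕ) :
    FreeAlgebra ℂ (Fin (n - 1)) → FreeAlgebra ℂ (Fin (n - 1)) → Prop
  | quad (i : Fin (n - 1)) :
      HARel q0 n ((TA q0 n i - algebraMap ℂ _ q0) * (TA q0 n i + 1)) 0
  | braid (i j : Fin (n - 1)) (h : j.val = i.val + 1) :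
      HARel q0 n (TA q0 n i * TA q0 n j * TA q0 n i) (TA q0 n j * TA q0 n i * TA q0 n j)
  | comm (i j : Fin (n - 1)) (h : i.val + 1 < j.val ∨ j.val + 1 < i.val) :
      HARel q0 n (TA q0 n i * TA q0 n j) (TA q0 n j * TA q0 n i)

/-- The Hecke algebra `H_n(q₀)` of type `A_{n-1}`. -/
abbrev HA (q0 : ℂ) (n : ℕ) := RingQuot (HARel q0 n)

/-- The image of `T_i` in the Hecke algebra. -/
def Tmk (q0 : ℂ) (n : ℕ) (i : Fin (n - 1)) : HA q0 n :=
  RingQuot.mkAlgHom ℂ (HARel q0 n) (TA q0 n i)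

/-- The element `T₁T₂T₁ + T₁T₂ + T₂T₁ + T₁ + T₂ + 1` of `H_n(q²)`. -/
def kerGen2 (q : ℂ) (n : ℕ) (hn : 3 ≤ n) : HA (q ^ 2) n :=
  Tmk (q ^ 2) n ⟨0, by omega⟩ * Tmk (q ^ 2) n ⟨1, by omega⟩ * Tmk (q ^ 2) n ⟨0, by omega⟩ +
    Tmk (q ^ 2) n ⟨0, by omega⟩ * Tmk (q ^ 2) n ⟨1, by omega⟩ +
    Tmk (q ^ 2) n ⟨1, by omega⟩ * Tmk (q ^ 2) n ⟨0, by omega⟩ +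
    Tmk (q ^ 2) n ⟨0, by omega⟩ + Tmk (q ^ 2) n ⟨1, by omega⟩ + 1

section Relations

variable {A : Type*} [Ring A]

/-- The element `aba + ab + ba + a + b + 1`. -/
def symElt (a b : A) : A := a * b * a + a * b + b * a + a + b + 1

theorem symElt_comm {a b : A} (h : a * b * a = b * a * b) : symElt a b = symElt b a := by
  simp only [symElt, h]
  abel

theorem mul_symElt_of_braid {a b c : A} (hab : a * b * a = b * a * b)
    (hbc : b * c * b = c * b * c) (hac : a * c = c * a) :
    a * b * c * symElt a b = symElt b c * (a * b * c) := by
  have h₁ : a * b * c * a = b * (a * b * c) := by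
    rw [mul_assoc, ← hac, ← mul_assoc, hab]
    simp only [mul_assoc]
  have h₂ : a * b * c * b = c * (a * b * c) := by
    calc a * b * c * b = a * (b * c * b) := by simp only [mul_assoc]
      _ = a * c * b * c := by rw [hbc]; simp only [mul_assoc]
      _ = c * (a * b * c) := by rw [hac]; simp only [mul_assoc]
  simp only [symElt, mul_add, add_mul, ← mul_assoc, mul_one, one_mul] at h₁ h₂ ⊢
  have h₃ : a * b * c * a * b = b * c * a * b * c := by
    rw [h₁]; simp only [mul_assoc] at h₂ ⊢; rw [h₂]
  have h₄ : a * b * c * b * a = c * b * a * b * c := by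
    rw [h₂]; simp only [mul_assoc] at h₁ ⊢; rw [h₁]
  have h₅ : a * b * c * a * b * a = b * c * b * a * b * c := by
    rw [h₃]; simp only [mul_assoc] at h₁ ⊢; rw [h₁]
  rw [h₅, h₃, h₄, h₁, h₂]

variable [Algebra ℂ A]

theorem quad_eq_zero_iff (p : ℂ) (a : A) :
    (a - algebraMap ℂ A p) * (a + 1) = 0 ↔ a * a = (p - 1) • a + p • (1 : A) := by
  rw [← sub_eq_zero (a := a * a)]
  refine Eq.congr_left ?_
  simp only [Algebra.algebraMap_eq_smul_one, sub_mul, mul_add, smul_mul_assoc, one_mul, mul_one]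
  module

theorem isUnit_of_quad {p : ℂ} (hp : p ≠ 0) {a : A}
    (h : a * a = (p - 1) • a + p • (1 : A)) : IsUnit a := by
  refine isUnit_iff_exists.2 ⟨p⁻¹ • (a - (p - 1) • (1 : A)), ?_, ?_⟩ <;>
  · simp only [mul_smul_comm, smul_mul_assoc, mul_sub, sub_mul, mul_one, one_mul, h]
    match_scalars <;> field_simp
    ring

theorem symElt_eq_zero_of_braid {p : ℂ} (hp : p ≠ 0) {a b c : A}
    (ha : a * a = (p - 1) • a + p • (1 : A)) (hb : b * b = (p - 1) • b + p • (1 : A))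
    (hc : c * c = (p - 1) • c + p • (1 : A)) (hab : a * b * a = b * a * b)
    (hbc : b * c * b = c * b * c) (hac : a * c = c * a) (h : symElt a b = 0) :
    symElt b c = 0 := by
  have hu : IsUnit (a * b * c) :=
    ((isUnit_of_quad hp ha).mul (isUnit_of_quad hp hb)).mul (isUnit_of_quad hp hc)
  rw [← hu.mul_left_eq_zero, ← mul_symElt_of_braid hab hbc hac, h, mul_zero]

theorem quad_of_sq {q : ℂ} (hq : q ≠ 0) {u : A} (hu : u * u = (-(q + q⁻¹)) • u) :
    (-(q • u) - 1) * (-(q • u) - 1) =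
      (q ^ 2 - 1) • (-(q • u) - 1) + q ^ 2 • (1 : A) := by
  simp only [mul_sub, sub_mul, neg_mul, mul_neg, smul_mul_assoc, mul_smul_comm, mul_one, one_mul,
    hu]
  match_scalars <;> field_simp <;> ring

theorem symElt_of_sq {q : ℂ} (hq : q ≠ 0) {u v : A} (hu : u * u = (-(q + q⁻¹)) • u)
    (huv : u * v * u = u) : symElt (-(q • u) - 1) (-(q • v) - 1) = 0 := by
  simp only [symElt, mul_sub, sub_mul, neg_mul, mul_neg, smul_mul_assoc, mul_smul_comm, mul_one,
    one_mul, hu, huv]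
  match_scalars <;> field_simp <;> ring

theorem braid_of_sq {q : ℂ} (hq : q ≠ 0) {u v : A} (hu : u * u = (-(q + q⁻¹)) • u)
    (hv : v * v = (-(q + q⁻¹)) • v) (huv : u * v * u = u) (hvu : v * u * v = v) :
    (-(q • u) - 1) * (-(q • v) - 1) * (-(q • u) - 1) =
      (-(q • v) - 1) * (-(q • u) - 1) * (-(q • v) - 1) := by
  have h := (symElt_of_sq hq hu huv).trans (symElt_of_sq hq hv hvu).symm
  simp only [symElt] at h
  rw [← sub_eq_zero] at h ⊢
  rw [← h]
  abel

theorem sq_of_quad {q : ℂ} (hq : q ≠ 0) {a : A}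
    (ha : a * a = (q ^ 2 - 1) • a + q ^ 2 • (1 : A)) :
    (-(q⁻¹ • (a + 1))) * (-(q⁻¹ • (a + 1))) = (-(q + q⁻¹)) • (-(q⁻¹ • (a + 1))) := by
  simp only [mul_add, add_mul, neg_mul, mul_neg, smul_mul_assoc, mul_smul_comm, smul_add, mul_one,
    one_mul, ha]
  match_scalars <;> field_simp <;> ring

theorem mul_mul_of_symElt {q : ℂ} (hq : q ≠ 0) {a b : A}
    (ha : a * a = (q ^ 2 - 1) • a + q ^ 2 • (1 : A)) (h : symElt a b = 0) :
    (-(q⁻¹ • (a + 1))) * (-(q⁻¹ • (b + 1))) * (-(q⁻¹ • (a + 1))) = -(q⁻¹ • (a + 1)) := by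
  have h' : a * b * a = -(a * b + b * a + a + b + 1) := by
    rw [eq_neg_iff_add_eq_zero, ← h, symElt]
    abel
  simp only [mul_add, add_mul, neg_mul, mul_neg, smul_mul_assoc, mul_smul_comm, smul_add, mul_one,
    one_mul, ha, h']
  match_scalars <;> field_simp <;> ring

end Relations

section Generators

theorem UmkTL_mul_self (q : ℂ) (n : ℕ) (i : Fin (n - 1)) :
    UmkTL q n i * UmkTL q n i = (-(q + q⁻¹)) • UmkTL q n i := by
  simpa only [UmkTL, map_mul, map_smul] using RingQuot.mkAlgHom_rel ℂ (TLRel.Usq (q := q) i)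

theorem UmkTL_mul_mul (q : ℂ) (n : ℕ) {i j : Fin (n - 1)}
    (h : i.val + 1 = j.val ∨ j.val + 1 = i.val) :
    UmkTL q n i * UmkTL q n j * UmkTL q n i = UmkTL q n i := by
  simpa only [UmkTL, map_mul] using RingQuot.mkAlgHom_rel ℂ (TLRel.UUU (q := q) i j h)

theorem UmkTL_comm (q : ℂ) (n : ℕ) {i j : Fin (n - 1)}
    (h : i.val + 1 < j.val ∨ j.val + 1 < i.val) :
    UmkTL q n i * UmkTL q n j = UmkTL q n j * UmkTL q n i := by
  simpa only [UmkTL, map_mul] using RingQuot.mkAlgHom_rel ℂ (TLRel.Ucomm (q := q) i j h)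

theorem Tmk_quad (p : ℂ) (n : ℕ) (i : Fin (n - 1)) :
    Tmk p n i * Tmk p n i = (p - 1) • Tmk p n i + p • (1 : HA p n) := by
  rw [← quad_eq_zero_iff]
  simpa only [Tmk, map_mul, map_sub, map_add, map_one, map_zero, AlgHom.commutes] using
    RingQuot.mkAlgHom_rel ℂ (HARel.quad (q0 := p) i)

theorem Tmk_braid (p : ℂ) (n : ℕ) {i j : Fin (n - 1)} (h : j.val = i.val + 1) :
    Tmk p n i * Tmk p n j * Tmk p n i = Tmk p n j * Tmk p n i * Tmk p n j := by
  simpa only [Tmk, map_mul] using RingQuot.mkAlgHom_rel ℂ (HARel.braid (q0 := p) i j h)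

theorem Tmk_comm (p : ℂ) (n : ℕ) {i j : Fin (n - 1)}
    (h : i.val + 1 < j.val ∨ j.val + 1 < i.val) :
    Tmk p n i * Tmk p n j = Tmk p n j * Tmk p n i := by
  simpa only [Tmk, map_mul] using RingQuot.mkAlgHom_rel ℂ (HARel.comm (q0 := p) i j h)

variable {A : Type*} [Ring A] [Algebra ℂ A]

theorem HA_hom_ext {p : ℂ} {n : ℕ} {f g : HA p n →ₐ[ℂ] A}
    (h : ∀ i, f (Tmk p n i) = g (Tmk p n i)) : f = g :=
  RingQuot.ringQuot_ext' _ _ _ (FreeAlgebra.hom_ext (funext h))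

theorem TL_hom_ext {q : ℂ} {n : ℕ} {f g : TL q n →ₐ[ℂ] A}
    (h : ∀ i, f (UmkTL q n i) = g (UmkTL q n i)) : f = g :=
  RingQuot.ringQuot_ext' _ _ _ (FreeAlgebra.hom_ext (funext h))

theorem exists_HA_hom {p : ℂ} {n : ℕ} (t : Fin (n - 1) → A)
    (quad : ∀ i, t i * t i = (p - 1) • t i + p • (1 : A))
    (braid : ∀ i j : Fin (n - 1), j.val = i.val + 1 → t i * t j * t i = t j * t i * t j)
    (comm : ∀ i j : Fin (n - 1), i.val + 1 < j.val ∨ j.val + 1 < i.val → t i * t j = t j * t i) :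
    ∃ f : HA p n →ₐ[ℂ] A, ∀ i, f (Tmk p n i) = t i := by
  refine ⟨RingQuot.liftAlgHom ℂ ⟨FreeAlgebra.lift ℂ t, ?_⟩, fun i => ?_⟩
  · rintro _ _ (i | ⟨i, j, h⟩ | ⟨i, j, h⟩)
    · simpa [TA] using (quad_eq_zero_iff p (t i)).2 (quad i)
    · simpa [TA] using braid i j h
    · simpa [TA] using comm i j h
  · rw [Tmk, RingQuot.liftAlgHom_mkAlgHom_apply, TA, FreeAlgebra.lift_ι_apply]

theorem exists_TL_hom {q : ℂ} {n : ℕ} (u : Fin (n - 1) → A)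
    (sq : ∀ i, u i * u i = (-(q + q⁻¹)) • u i)
    (mul_mul : ∀ i j : Fin (n - 1), i.val + 1 = j.val ∨ j.val + 1 = i.val →
      u i * u j * u i = u i)
    (comm : ∀ i j : Fin (n - 1), i.val + 1 < j.val ∨ j.val + 1 < i.val → u i * u j = u j * u i) :
    ∃ f : TL q n →ₐ[ℂ] A, ∀ i, f (UmkTL q n i) = u i := by
  refine ⟨RingQuot.liftAlgHom ℂ ⟨FreeAlgebra.lift ℂ u, ?_⟩, fun i => ?_⟩
  · rintro _ _ (i | ⟨i, j, h⟩ | ⟨i, j, h⟩)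
    · simpa only [UT, map_mul, map_smul, FreeAlgebra.lift_ι_apply] using sq i
    · simpa [UT] using mul_mul i j h
    · simpa [UT] using comm i j h
  · rw [UmkTL, RingQuot.liftAlgHom_mkAlgHom_apply, UT, FreeAlgebra.lift_ι_apply]

theorem kerGen2_eq_symElt (q : ℂ) (n : ℕ) (hn : 3 ≤ n) :
    kerGen2 q n hn = symElt (Tmk (q ^ 2) n ⟨0, by omega⟩) (Tmk (q ^ 2) n ⟨1, by omega⟩) :=
  rfl

theorem map_symElt {B : Type*} [Ring B] [Algebra ℂ B] (f : A →ₐ[ℂ] B) (a b : A) :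
    f (symElt a b) = symElt (f a) (f b) := by
  simp [symElt]

theorem map_symElt_Tmk_eq_zero {q : ℂ} (hq : q ≠ 0) {n : ℕ} (hn : 3 ≤ n)
    (f : HA (q ^ 2) n →ₐ[ℂ] A) (hf : f (kerGen2 q n hn) = 0) {i j : Fin (n - 1)}
    (h : i.val + 1 = j.val) : symElt (f (Tmk (q ^ 2) n i)) (f (Tmk (q ^ 2) n j)) = 0 := by
  have quad (i) : f (Tmk (q ^ 2) n i) * f (Tmk (q ^ 2) n i) =
      (q ^ 2 - 1) • f (Tmk (q ^ 2) n i) + q ^ 2 • (1 : A) := by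
    rw [← map_mul, Tmk_quad, map_add, map_smul, map_smul, map_one]
  have braid {i j : Fin (n - 1)} (h : j.val = i.val + 1) :
      f (Tmk (q ^ 2) n i) * f (Tmk (q ^ 2) n j) * f (Tmk (q ^ 2) n i) =
        f (Tmk (q ^ 2) n j) * f (Tmk (q ^ 2) n i) * f (Tmk (q ^ 2) n j) := by
    simp only [← map_mul, Tmk_braid _ _ h]
  obtain ⟨i, hi⟩ := i
  obtain ⟨j, hj⟩ := j
  obtain rfl : i + 1 = j := h
  induction i with
  | zero => rwa [kerGen2_eq_symElt, map_symElt] at hf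
  | succ i ih =>
    refine symElt_eq_zero_of_braid (pow_ne_zero 2 hq) (quad ⟨i, by omega⟩) (quad _) (quad _)
      (braid rfl) (braid rfl) ?_ (ih (by omega) hi)
    rw [← map_mul, Tmk_comm _ _ (Or.inl (by simp)), map_mul]

theorem exists_TL_hom_of_map_kerGen2 {q : ℂ} (hq : q ≠ 0) {n : ℕ} (hn : 3 ≤ n)
    (f : HA (q ^ 2) n →ₐ[ℂ] A) (hf : f (kerGen2 q n hn) = 0) :
    ∃ g : TL q n →ₐ[ℂ] A, ∀ i, g (UmkTL q n i) = -(q⁻¹ • (f (Tmk (q ^ 2) n i) + 1)) := by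
  have quad (i) : f (Tmk (q ^ 2) n i) * f (Tmk (q ^ 2) n i) =
      (q ^ 2 - 1) • f (Tmk (q ^ 2) n i) + q ^ 2 • (1 : A) := by
    rw [← map_mul, Tmk_quad, map_add, map_smul, map_smul, map_one]
  refine exists_TL_hom _ (fun i => sq_of_quad hq (quad i)) (fun i j h => ?_) (fun i j h => ?_)
  · refine mul_mul_of_symElt hq (quad i) ?_
    rcases h with h | h
    · exact map_symElt_Tmk_eq_zero hq hn f hf h
    · rw [← map_symElt, ← symElt_comm (Tmk_braid _ _ h.symm), map_symElt]
      exact map_symElt_Tmk_eq_zero hq hn f hf h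
  · have hc : Commute (f (Tmk (q ^ 2) n i)) (f (Tmk (q ^ 2) n j)) :=
      (show Commute _ _ from Tmk_comm _ _ h).map f
    exact ((((hc.add_right (.one_right _)).add_left (.one_left _)).smul_left _).smul_right
      _).neg_left.neg_right

end Generators

/-- For `q ≠ 0`, `q² ≠ 1` and `n ≥ 3` there is a unique `ℂ`-algebra
homomorphism `Φ₂ : H_n(q²) → Tl_n(q)` with `Φ₂(T_i) = -qU_i - 1`; it is surjective and its
kernel is the two-sided ideal generated by `T₁T₂T₁ + T₁T₂ + T₂T₁ + T₁ + T₂ + 1`. -/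
theorem statement7 (q : ℂ) (hq : q ≠ 0) (hq2 : q ^ 2 ≠ 1) (n : ℕ) (hn : 3 ≤ n) :
    ∃ Φ : HA (q ^ 2) n →ₐ[ℂ] TL q n,
      (∀ i : Fin (n - 1), Φ (Tmk (q ^ 2) n i) = -(q • UmkTL q n i) - 1) ∧
      Function.Surjective Φ ∧
      (∀ x : HA (q ^ 2) n, Φ x = 0 ↔ x ∈ TwoSidedIdeal.span {kerGen2 q n hn}) ∧
      (∀ Ψ : HA (q ^ 2) n →ₐ[ℂ] TL q n,
        (∀ i : Fin (n - 1), Ψ (Tmk (q ^ 2) n i) = -(q • UmkTL q n i) - 1) →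
        Ψ = Φ) := by
  obtain ⟨Φ, hΦ⟩ := exists_HA_hom (p := q ^ 2) (fun i => -(q • UmkTL q n i) - 1)
    (fun i => quad_of_sq hq (UmkTL_mul_self q n i))
    (fun i j h => braid_of_sq hq (UmkTL_mul_self q n i) (UmkTL_mul_self q n j)
      (UmkTL_mul_mul q n (.inl h.symm)) (UmkTL_mul_mul q n (.inr h.symm)))
    (fun i j h => by
      have hc : Commute (UmkTL q n i) (UmkTL q n j) := UmkTL_comm q n h
      exact ((hc.smul_left q).smul_right q).neg_left.neg_right.sub_right (.one_right _)
        |>.sub_left (.one_left _))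
  have hgen : Φ (kerGen2 q n hn) = 0 := by
    rw [kerGen2_eq_symElt, map_symElt, hΦ, hΦ]
    exact symElt_of_sq hq (UmkTL_mul_self q n _) (UmkTL_mul_mul q n (.inl rfl))
  refine ⟨Φ, hΦ, ?_, fun x => ⟨fun hx => ?_, fun hx => ?_⟩,
    fun Ψ hΨ => HA_hom_ext fun i => (hΨ i).trans (hΦ i).symm⟩
  · have hgen' : Φ.rangeRestrict (kerGen2 q n hn) = 0 := Subtype.ext hgen
    obtain ⟨s, hs⟩ := exists_TL_hom_of_map_kerGen2 (A := Φ.range) hq hn _ hgen'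
    have h : Φ.range.val.comp s = AlgHom.id ℂ _ := TL_hom_ext fun i => by
      rw [AlgHom.comp_apply, hs, AlgHom.id_apply]
      change -(q⁻¹ • (Φ (Tmk (q ^ 2) n i) + 1)) = _
      simp [hΦ, smul_smul, hq]
    exact fun y => by simpa using ((DFunLike.congr_fun h y) ▸ (s y).2 : (AlgHom.id ℂ _) y ∈ Φ.range)
  · set I := TwoSidedIdeal.span {kerGen2 q n hn}
    let π : HA (q ^ 2) n →ₐ[ℂ] I.ringCon.Quotient := I.ringCon.mkₐ ℂ
    have hπ (y) : π y = 0 ↔ y ∈ I := I.ringCon.eq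
    obtain ⟨g, hg⟩ := exists_TL_hom_of_map_kerGen2 hq hn π
      ((hπ _).2 (TwoSidedIdeal.subset_span rfl))
    have h : g.comp Φ = π := HA_hom_ext fun i => by
      simp [hΦ, hg, smul_smul, hq]
    rw [← hπ, ← h, AlgHom.comp_apply, hx, map_zero]
  · have hle : TwoSidedIdeal.span {kerGen2 q n hn} ≤ TwoSidedIdeal.ker Φ :=
      TwoSidedIdeal.span_le.2 (by simpa [TwoSidedIdeal.mem_ker] using hgen)
    exact (TwoSidedIdeal.mem_ker _).1 (hle hx)

end Statement7
end
end

section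
/- Let R be a commutative ring, m ∈ ℤ, and q ∈ R a unit such that q − q^{−1} and [m] := (q^m − q^{−m})/(q − q^{−1}) are also units of R. Then there is a unique surjective R-algebra homomorphism Φ from the cyclotomic Hecke algebra H_n^R(q²; q^m, q^{−m}) (defined over R by generators and relations) onto the blob algebra b_n^R(m) (defined over R by generators and relations) such that Φ(T_i) = qU_i + q² for 1 ≤ i ≤ n−1 and Φ(L_1) = (q − q^{−1})U_0 + q^m, where U_0 := −[m]e. -/
noncomputable section

namespace Statement8

variable (R : Type*) [CommRing R]

/-- The Gaussian integer `[j] = (q^j - q^{-j})·(q - q⁻¹)⁻¹`, with `q` a unit and `v` the unit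
`q - q⁻¹`. -/
def gaussR (q v : Rˣ) (j : ℤ) : R :=
  (((q ^ j : Rˣ) : R) - ((q ^ (-j) : Rˣ) : R)) * ((v⁻¹ : Rˣ) : R)

/-- Generators of the blob algebra: `e` and `U_1, …, U_{n-1}` (0-indexed). -/
inductive BlobGen (n : ℕ) : Type
  | e : BlobGen n
  | U : Fin (n - 1) → BlobGen n

/-- The generator `e` in the free algebra. -/
def eF (n : ℕ) : FreeAlgebra R (BlobGen n) := FreeAlgebra.ι R BlobGen.e

/-- The generator `U_i` in the free algebra. -/
def UF (n : ℕ) (i : Fin (n - 1)) : FreeAlgebra R (BlobGen n) :=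
  FreeAlgebra.ι R (BlobGen.U i)

/-- The defining relations of the blob algebra `b_n^R(m)` over `R`; here
`y_e = -[m-1]·[m]⁻¹`. -/
inductive BlobRel (q v : Rˣ) (m : ℤ) (n : ℕ) :
    FreeAlgebra R (BlobGen n) → FreeAlgebra R (BlobGen n) → Prop
  | Usq (i : Fin (n - 1)) :
      BlobRel q v m n (UF R n i * UF R n i) ((-((q : R) + ((q⁻¹ : Rˣ) : R))) • UF R n i)
  | UUU (i j : Fin (n - 1)) (h : i.val + 1 = j.val ∨ j.val + 1 = i.val) :
      BlobRel q v m n (UF R n i * UF R n j * UF R n i) (UF R n i)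
  | Ucomm (i j : Fin (n - 1)) (h : i.val + 1 < j.val ∨ j.val + 1 < i.val) :
      BlobRel q v m n (UF R n i * UF R n j) (UF R n j * UF R n i)
  | UeU (i : Fin (n - 1)) (h : i.val = 0) :
      BlobRel q v m n (UF R n i * eF R n * UF R n i)
        ((-(gaussR R q v (m - 1) * Ring.inverse (gaussR R q v m))) • UF R n i)
  | ee : BlobRel q v m n (eF R n * eF R n) (eF R n)
  | Ue (i : Fin (n - 1)) (h : 1 ≤ i.val) :
      BlobRel q v m n (UF R n i * eF R n) (eF R n * UF R n i)

/-- The blob algebra `b_n^R(m)` over `R`. -/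
abbrev Blob (q v : Rˣ) (m : ℤ) (n : ℕ) := RingQuot (BlobRel R q v m n)

/-- The image of `e` in the blob algebra. -/
def emk (q v : Rˣ) (m : ℤ) (n : ℕ) : Blob R q v m n :=
  RingQuot.mkAlgHom R (BlobRel R q v m n) (eF R n)

/-- The image of `U_i` in the blob algebra. -/
def Umk (q v : Rˣ) (m : ℤ) (n : ℕ) (i : Fin (n - 1)) : Blob R q v m n :=
  RingQuot.mkAlgHom R (BlobRel R q v m n) (UF R n i)

/-- The rescaled generator `U_0 = -[m]·e`. -/
def U0el (q v : Rˣ) (m : ℤ) (n : ℕ) : Blob R q v m n :=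
  (-(gaussR R q v m)) • emk R q v m n

/-- Generators of the cyclotomic Hecke algebra of type `G(2,1,n)`. -/
inductive HGen (n : ℕ) : Type
  | L : Fin n → HGen n
  | T : Fin (n - 1) → HGen n

/-- The generator `L_r` in the free algebra. -/
def LF (n : ℕ) (r : Fin n) : FreeAlgebra R (HGen n) := FreeAlgebra.ι R (HGen.L r)

/-- The generator `T_r` in the free algebra. -/
def TF (n : ℕ) (r : Fin (n - 1)) : FreeAlgebra R (HGen n) := FreeAlgebra.ι R (HGen.T r)

/-- The position `r` as an element of `Fin n`. -/
def lo {n : ℕ} (r : Fin (n - 1)) : Fin n := ⟨r.val, by have := r.2; omega⟩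

/-- The position `r + 1` as an element of `Fin n`. -/
def hi {n : ℕ} (r : Fin (n - 1)) : Fin n := ⟨r.val + 1, by have := r.2; omega⟩

/-- The defining relations of the cyclotomic Hecke algebra `H_n^R(q₀; λ₁, λ₂)` over `R`. -/
inductive HRel (q0 l1 l2 : R) (n : ℕ) :
    FreeAlgebra R (HGen n) → FreeAlgebra R (HGen n) → Prop
  | cyclo (r : Fin n) (h : r.val = 0) :
      HRel q0 l1 l2 n
        ((LF R n r - algebraMap R _ l1) * (LF R n r - algebraMap R _ l2)) 0
  | LL (r s : Fin n) : HRel q0 l1 l2 n (LF R n r * LF R n s) (LF R n s * LF R n r)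
  | quad (r : Fin (n - 1)) :
      HRel q0 l1 l2 n ((TF R n r + 1) * (TF R n r - algebraMap R _ q0)) 0
  | TLrel (r : Fin (n - 1)) :
      HRel q0 l1 l2 n (TF R n r * LF R n (lo r))
        (LF R n (hi r) * (TF R n r - algebraMap R _ q0 + 1))
  | braid (r s : Fin (n - 1)) (h : s.val = r.val + 1) :
      HRel q0 l1 l2 n (TF R n r * TF R n s * TF R n r) (TF R n s * TF R n r * TF R n s)
  | TLcomm (r : Fin (n - 1)) (s : Fin n) (h : r.val + 1 < s.val ∨ s.val + 1 < r.val) :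
      HRel q0 l1 l2 n (TF R n r * LF R n s) (LF R n s * TF R n r)
  | TT (r s : Fin (n - 1)) (h : r.val + 1 < s.val ∨ s.val + 1 < r.val) :
      HRel q0 l1 l2 n (TF R n r * TF R n s) (TF R n s * TF R n r)

/-- The cyclotomic Hecke algebra `H_n^R(q²; q^m, q^{-m})` over `R`. -/
abbrev Hm (q : Rˣ) (m : ℤ) (n : ℕ) :=
  RingQuot (HRel R ((q : R) ^ 2) (((q ^ m : Rˣ) : R)) (((q ^ (-m) : Rˣ) : R)) n)

/-- The image of `L_r` in `H_n^R(q²; q^m, q^{-m})`. -/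
def Lmk (q : Rˣ) (m : ℤ) (n : ℕ) (r : Fin n) : Hm R q m n :=
  RingQuot.mkAlgHom R (HRel R ((q : R) ^ 2) (((q ^ m : Rˣ) : R)) (((q ^ (-m) : Rˣ) : R)) n)
    (LF R n r)

/-- The image of `T_r` in `H_n^R(q²; q^m, q^{-m})`. -/
def Tmk (q : Rˣ) (m : ℤ) (n : ℕ) (r : Fin (n - 1)) : Hm R q m n :=
  RingQuot.mkAlgHom R (HRel R ((q : R) ^ 2) (((q ^ m : Rˣ) : R)) (((q ^ (-m) : Rˣ) : R)) n)
    (TF R n r)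

section JucysMurphy

variable {R} {A : Type*} [Ring A] [Algebra R A]

/-- The Jucys-Murphy sequence `L₀ = x`, `L_{r+1} = c · T_r L_r T_r`. -/
def jm (c : R) (T : ℕ → A) (x : A) : ℕ → A
  | 0 => x
  | r + 1 => c • (T r * jm c T x r * T r)

variable {c : R} {T : ℕ → A} {x : A}

theorem commute_jm_of_lt (hTT : ∀ i j, i + 1 < j → Commute (T i) (T j))
    (hTx : ∀ i, 1 ≤ i → Commute (T i) x) {i j : ℕ} (h : j < i) :
    Commute (T i) (jm c T x j) := by
  induction j with
  | zero => exact hTx i h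
  | succ j ih =>
    have hc := (hTT j i h).symm
    exact (((hc.mul_right (ih (by omega))).mul_right hc).smul_right c)

theorem commute_jm_of_gt (hTT : ∀ i j, i + 1 < j → Commute (T i) (T j))
    (hbraid : ∀ i, T i * T (i + 1) * T i = T (i + 1) * T i * T (i + 1))
    (hTx : ∀ i, 1 ≤ i → Commute (T i) x) {i j : ℕ} (h : i + 1 < j) :
    Commute (T i) (jm c T x j) := by
  induction j, h using Nat.le_induction with
  | base =>
    have hL : Commute (T (i + 1)) (jm c T x i) := commute_jm_of_lt hTT hTx (by omega)
    have hb := hbraid i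
    have key : Commute (T i) (T (i + 1) * (T i * jm c T x i * T i) * T (i + 1)) := by
      generalize jm c T x i = L at *
      generalize T i = S at *
      generalize T (i + 1) = T' at *
      calc S * (T' * (S * L * S) * T') = S * T' * S * L * S * T' := by noncomm_ring
        _ = T' * S * (T' * L) * S * T' := by rw [hb]; noncomm_ring
        _ = T' * S * L * (T' * S * T') := by rw [hL.eq]; noncomm_ring
        _ = T' * (S * L * S) * T' * S := by rw [← hb]; noncomm_ring
    simp only [jm, mul_smul_comm, smul_mul_assoc]
    exact (key.smul_right c).smul_right c
  | succ j hj ih =>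
    have hc := hTT i j hj
    exact ((hc.mul_right ih).mul_right hc).smul_right c

theorem commute_jm_jm (hTT : ∀ i j, i + 1 < j → Commute (T i) (T j))
    (hbraid : ∀ i, T i * T (i + 1) * T i = T (i + 1) * T i * T (i + 1))
    (hTx : ∀ i, 1 ≤ i → Commute (T i) x) (hx : Commute x (T 0 * x * T 0)) (i j : ℕ) :
    Commute (jm c T x i) (jm c T x j) := by
  have extend {k l : ℕ} (hkl : k < l) (h : Commute (jm c T x k) (jm c T x l)) :
      Commute (jm c T x k) (jm c T x (l + 1)) := by
    have hc := (commute_jm_of_lt (c := c) hTT hTx hkl).symm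
    exact ((hc.mul_right h).mul_right hc).smul_right c
  have adjacent (k : ℕ) : Commute (jm c T x k) (jm c T x (k + 1)) := by
    induction k with
    | zero => exact hx.smul_right c
    | succ k ih =>
      have hT : Commute (T k) (jm c T x (k + 2)) :=
        commute_jm_of_gt hTT hbraid hTx (by omega)
      exact ((hT.mul_left (extend (by omega) ih)).mul_left hT).smul_left c
  have lt {k l : ℕ} (h : k < l) : Commute (jm c T x k) (jm c T x l) := by
    induction l, h using Nat.le_induction with
    | base => exact adjacent k
    | succ l hl ih => exact extend hl ih
  rcases lt_trichotomy i j with h | rfl | h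
  · exact lt h
  · exact Commute.refl _
  · exact (lt h).symm

end JucysMurphy

section Generators

variable {R} {A : Type*} [Ring A] [Algebra R A] (q : Rˣ)

/-- The Hecke generator `q U + q²` attached to a Temperley-Lieb generator `U`. -/
def heckeOf (U : A) : A := (q : R) • U + algebraMap R A ((q : R) ^ 2)

variable {q} {U V e : A}

theorem heckeOf_mul_sub_add_one
    (hU : U * U = (-((q : R) + ((q⁻¹ : Rˣ) : R))) • U) :
    heckeOf q U * (heckeOf q U - algebraMap R A ((q : R) ^ 2) + 1) =
      algebraMap R A ((q : R) ^ 2) := by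
  simp only [heckeOf, Algebra.algebraMap_eq_smul_one, add_sub_cancel_right, add_mul, mul_add,
    smul_mul_assoc, mul_smul_comm, one_mul, mul_one, hU]
  have h := q.mul_inv
  match_scalars
  · linear_combination (-(q : R)) * h
  · ring

theorem heckeOf_quadratic
    (hU : U * U = (-((q : R) + ((q⁻¹ : Rˣ) : R))) • U) :
    (heckeOf q U + 1) * (heckeOf q U - algebraMap R A ((q : R) ^ 2)) = 0 := by
  simp only [heckeOf, Algebra.algebraMap_eq_smul_one, add_sub_cancel_right, add_mul,
    smul_mul_assoc, mul_smul_comm, one_mul, hU]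
  have h := q.mul_inv
  match_scalars
  linear_combination (-(q : R)) * h

theorem heckeOf_braid
    (hU : U * U = (-((q : R) + ((q⁻¹ : Rˣ) : R))) • U)
    (hV : V * V = (-((q : R) + ((q⁻¹ : Rˣ) : R))) • V)
    (hUV : U * V * U = U) (hVU : V * U * V = V) :
    heckeOf q U * heckeOf q V * heckeOf q U = heckeOf q V * heckeOf q U * heckeOf q V := by
  simp only [heckeOf, Algebra.algebraMap_eq_smul_one, add_mul, mul_add,
    smul_mul_assoc, mul_smul_comm, one_mul, mul_one, hU, hV, hUV, hVU]
  have h := q.mul_inv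
  match_scalars
  all_goals first
    | ring1
    | linear_combination (-(q : R) ^ 3) * h
    | linear_combination ((q : R) ^ 3) * h

theorem commute_heckeOf (h : Commute U V) : Commute (heckeOf q U) V :=
  (h.smul_left _).add_left (Algebra.commutes _ _)

/-- The type `B` braid relation. -/
theorem commute_typeB {a b y : R}
    (hab : a * q * y + a * q ^ 2 + b * (q ^ 2 - 1) = 0)
    (hU : U * U = (-((q : R) + ((q⁻¹ : Rˣ) : R))) • U)
    (he : e * e = e) (hUeU : U * e * U = y • U) :
    Commute (a • e + algebraMap R A b)
      (heckeOf q U * (a • e + algebraMap R A b) * heckeOf q U) := by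
  have h := q.mul_inv
  have expand : heckeOf q U * (a • e + algebraMap R A b) * heckeOf q U =
      (a * q ^ 2 * y + b * q * (q ^ 2 - 1)) • U + (a * q ^ 3) • (U * e + e * U)
        + (a * q ^ 4) • e + algebraMap R A (b * q ^ 4) := by
    simp only [heckeOf, Algebra.algebraMap_eq_smul_one, add_mul, mul_add,
      smul_mul_assoc, mul_smul_comm, one_mul, mul_one, hU, hUeU]
    match_scalars
    · linear_combination (-b * q) * h
    all_goals ring
  rw [expand]
  refine Commute.add_left (Commute.smul_left ?_ a) (Algebra.commutes _ _)
  refine Commute.add_right ?_ (Algebra.commutes _ _).symm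
  have heeU : e * (e * U) = e * U := by rw [← mul_assoc, he]
  have hUee : U * e * e = U * e := by rw [mul_assoc, he]
  rw [commute_iff_eq]
  simp only [mul_add, add_mul, smul_mul_assoc, mul_smul_comm, he, heeU, hUee, ← mul_assoc]
  match_scalars
  all_goals first
    | ring1
    | linear_combination (q : R) * hab
    | linear_combination (-(q : R)) * hab

end Generators

section BlobRelations

variable {R} {q v : Rˣ} {m : ℤ} {n : ℕ}

theorem Umk_mul_self (i : Fin (n - 1)) :
    Umk R q v m n i * Umk R q v m n i =
      (-((q : R) + ((q⁻¹ : Rˣ) : R))) • Umk R q v m n i := by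
  simpa only [Umk, emk, commute_iff_eq, map_mul, map_smul] using
    RingQuot.mkAlgHom_rel R (BlobRel.Usq (q := q) (v := v) (m := m) i)

theorem Umk_mul_Umk_mul_Umk (i j : Fin (n - 1)) (h : i.val + 1 = j.val ∨ j.val + 1 = i.val) :
    Umk R q v m n i * Umk R q v m n j * Umk R q v m n i = Umk R q v m n i := by
  simpa only [Umk, emk, commute_iff_eq, map_mul, map_smul] using
    RingQuot.mkAlgHom_rel R (BlobRel.UUU (q := q) (v := v) (m := m) i j h)

theorem commute_Umk_Umk (i j : Fin (n - 1)) (h : i.val + 1 < j.val ∨ j.val + 1 < i.val) :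
    Commute (Umk R q v m n i) (Umk R q v m n j) := by
  simpa only [Umk, emk, commute_iff_eq, map_mul, map_smul] using
    RingQuot.mkAlgHom_rel R (BlobRel.Ucomm (q := q) (v := v) (m := m) i j h)

theorem Umk_mul_emk_mul_Umk (i : Fin (n - 1)) (h : i.val = 0) :
    Umk R q v m n i * emk R q v m n * Umk R q v m n i =
      (-(gaussR R q v (m - 1) * Ring.inverse (gaussR R q v m))) • Umk R q v m n i := by
  simpa only [Umk, emk, commute_iff_eq, map_mul, map_smul] using
    RingQuot.mkAlgHom_rel R (BlobRel.UeU (q := q) (v := v) (m := m) i h)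

theorem emk_mul_self : emk R q v m n * emk R q v m n = emk R q v m n := by
  simpa only [Umk, emk, commute_iff_eq, map_mul, map_smul] using
    RingQuot.mkAlgHom_rel R (BlobRel.ee (q := q) (v := v) (m := m) (n := n))

theorem commute_Umk_emk (i : Fin (n - 1)) (h : 1 ≤ i.val) :
    Commute (Umk R q v m n i) (emk R q v m n) := by
  simpa only [Umk, emk, commute_iff_eq, map_mul, map_smul] using
    RingQuot.mkAlgHom_rel R (BlobRel.Ue (q := q) (v := v) (m := m) i h)

theorem sub_mul_gaussR (hv : (v : R) = (q : R) - ((q⁻¹ : Rˣ) : R)) (j : ℤ) :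
    ((q : R) - ((q⁻¹ : Rˣ) : R)) * gaussR R q v j =
      ((q ^ j : Rˣ) : R) - ((q ^ (-j) : Rˣ) : R) := by
  rw [← hv, gaussR, mul_left_comm, v.mul_inv, mul_one]

end BlobRelations

section HeckeImages

variable {R} (q v : Rˣ) (m : ℤ) (n : ℕ)

/-- The image of `L₁` in the blob algebra. -/
def blobL1 : Blob R q v m n :=
  ((q : R) - ((q⁻¹ : Rˣ) : R)) • U0el R q v m n + algebraMap R _ (((q ^ m : Rˣ) : R))

/-- The images of the `T_i` in the blob algebra, extended by zero to all indices. -/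
def blobT (i : ℕ) : Blob R q v m n :=
  if h : i < n - 1 then heckeOf q (Umk R q v m n ⟨i, h⟩) else 0

/-- The images of the `L_r` in the blob algebra. -/
def blobL : ℕ → Blob R q v m n :=
  jm (((q⁻¹ : Rˣ) : R) ^ 2) (blobT q v m n) (blobL1 q v m n)

variable {q v m n}

theorem blobT_val (i : Fin (n - 1)) : blobT q v m n i = heckeOf q (Umk R q v m n i) :=
  dif_pos i.2

theorem blobT_of_not_lt {i : ℕ} (h : ¬ i < n - 1) : blobT (R := R) q v m n i = 0 :=
  dif_neg h

theorem blobL1_eq (hv : (v : R) = (q : R) - ((q⁻¹ : Rˣ) : R)) :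
    blobL1 q v m n = (((q ^ (-m) : Rˣ) : R) - ((q ^ m : Rˣ) : R)) • emk R q v m n +
      algebraMap R _ (((q ^ m : Rˣ) : R)) := by
  rw [blobL1, U0el, smul_smul, mul_neg, sub_mul_gaussR hv, neg_sub]

theorem commute_blobT_blobT (i j : ℕ) (h : i + 1 < j) :
    Commute (blobT (R := R) q v m n i) (blobT q v m n j) := by
  by_cases hj : j < n - 1
  · have hU := commute_Umk_Umk (R := R) (q := q) (v := v) (m := m)
      ⟨i, by omega⟩ ⟨j, hj⟩ (Or.inl h)
    rw [blobT_val ⟨j, hj⟩, blobT_val ⟨i, by omega⟩]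
    exact commute_heckeOf (commute_heckeOf hU.symm).symm
  · rw [blobT_of_not_lt hj]
    exact Commute.zero_right _

theorem blobT_braid (i : ℕ) :
    blobT (R := R) q v m n i * blobT q v m n (i + 1) * blobT q v m n i =
      blobT q v m n (i + 1) * blobT q v m n i * blobT q v m n (i + 1) := by
  by_cases hi : i + 1 < n - 1
  · rw [blobT_val ⟨i + 1, hi⟩, blobT_val ⟨i, by omega⟩]
    exact heckeOf_braid (Umk_mul_self _) (Umk_mul_self _)
      (Umk_mul_Umk_mul_Umk _ _ (Or.inl rfl)) (Umk_mul_Umk_mul_Umk _ _ (Or.inr rfl))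
  · simp [blobT_of_not_lt hi]

theorem commute_blobT_blobL1 (i : ℕ) (h : 1 ≤ i) :
    Commute (blobT (R := R) q v m n i) (blobL1 q v m n) := by
  by_cases hi : i < n - 1
  · rw [blobT_val ⟨i, hi⟩]
    exact commute_heckeOf ((((commute_Umk_emk _ h).smul_right _).smul_right _).add_right
      (Algebra.commutes _ _).symm)
  · rw [blobT_of_not_lt hi]
    exact Commute.zero_left _

theorem commute_blobL1_typeB (hv : (v : R) = (q : R) - ((q⁻¹ : Rˣ) : R))
    (hm : IsUnit (gaussR R q v m)) :
    Commute (blobL1 q v m n) (blobT q v m n 0 * blobL1 q v m n * blobT q v m n 0) := by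
  by_cases hn : 0 < n - 1
  · rw [blobL1_eq hv, blobT_val ⟨0, hn⟩]
    refine commute_typeB ?_ (Umk_mul_self _) emk_mul_self (Umk_mul_emk_mul_Umk _ rfl)
    have hg := sub_mul_gaussR hv m
    have hg' := sub_mul_gaussR hv (m - 1)
    have hinv := Ring.mul_inverse_cancel _ hm
    have hq := q.mul_inv
    have hz : q ^ (m - 1) = q ^ m * q⁻¹ := zpow_sub_one q m
    have hz' : q ^ (-(m - 1)) = q ^ (-m) * q := by
      rw [neg_sub, sub_eq_add_neg, add_comm, zpow_add_one]
    rw [hz, hz', Units.val_mul, Units.val_mul] at hg'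
    linear_combination (-(q : R) * gaussR R q v (m - 1) * Ring.inverse (gaussR R q v m)) * hg
      + (q : R) * ((q : R) - ((q⁻¹ : Rˣ) : R)) * gaussR R q v (m - 1) * hinv
      + (q : R) * hg' + ((q ^ m : Rˣ) : R) * hq
  · simp [blobT_of_not_lt hn]

theorem commute_blobL_blobL (hv : (v : R) = (q : R) - ((q⁻¹ : Rˣ) : R))
    (hm : IsUnit (gaussR R q v m)) (r s : ℕ) :
    Commute (blobL q v m n r) (blobL q v m n s) :=
  commute_jm_jm commute_blobT_blobT blobT_braid commute_blobT_blobL1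
    (commute_blobL1_typeB hv hm) r s

theorem commute_blobT_blobL {r s : ℕ} (h : r + 1 < s ∨ s < r) :
    Commute (blobT (R := R) q v m n r) (blobL q v m n s) :=
  h.elim (commute_jm_of_gt commute_blobT_blobT blobT_braid commute_blobT_blobL1)
    (commute_jm_of_lt commute_blobT_blobT commute_blobT_blobL1)

theorem blobL1_cyclotomic (hv : (v : R) = (q : R) - ((q⁻¹ : Rˣ) : R)) :
    (blobL1 q v m n - algebraMap R _ ((q ^ m : Rˣ) : R)) *
      (blobL1 q v m n - algebraMap R _ ((q ^ (-m) : Rˣ) : R)) = 0 := by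
  rw [blobL1_eq hv, add_sub_cancel_right, Algebra.algebraMap_eq_smul_one,
    Algebra.algebraMap_eq_smul_one]
  simp only [mul_sub, mul_add, smul_mul_assoc, mul_smul_comm, emk_mul_self, mul_one]
  module

theorem blobT_mul_blobL (r : Fin (n - 1)) :
    heckeOf q (Umk R q v m n r) * blobL q v m n r =
      blobL q v m n (r + 1) *
        (heckeOf q (Umk R q v m n r) - algebraMap R _ ((q : R) ^ 2) + 1) := by
  have hq : ((q⁻¹ : Rˣ) : R) ^ 2 * (q : R) ^ 2 = 1 := by
    rw [← mul_pow, q.inv_mul, one_pow]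
  have hrec : blobL q v m n (r + 1) = ((q⁻¹ : Rˣ) : R) ^ 2 •
      (heckeOf q (Umk R q v m n r) * blobL q v m n r * heckeOf q (Umk R q v m n r)) := by
    rw [← blobT_val]
    rfl
  rw [hrec, smul_mul_assoc, mul_assoc _ (heckeOf q (Umk R q v m n r)),
    heckeOf_mul_sub_add_one (Umk_mul_self r), Algebra.algebraMap_eq_smul_one, mul_smul_comm,
    smul_smul, hq, one_smul, mul_one]

/-- The assignment of images to the Hecke generators. -/
def genImage : HGen n → Blob R q v m n
  | .L r => blobL q v m n r
  | .T i => heckeOf q (Umk R q v m n i)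

theorem lift_genImage_rel (hv : (v : R) = (q : R) - ((q⁻¹ : Rˣ) : R))
    (hm : IsUnit (gaussR R q v m)) ⦃x y : FreeAlgebra R (HGen n)⦄
    (h : HRel R ((q : R) ^ 2) (((q ^ m : Rˣ) : R)) (((q ^ (-m) : Rˣ) : R)) n x y) :
    FreeAlgebra.lift R (genImage (q := q) (v := v) (m := m)) x =
      FreeAlgebra.lift R (genImage (q := q) (v := v) (m := m)) y := by
  have hL (r : Fin n) : FreeAlgebra.lift R (genImage (q := q) (v := v) (m := m)) (LF R n r) =
      blobL q v m n r := FreeAlgebra.lift_ι_apply _ _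
  have hT (r : Fin (n - 1)) :
      FreeAlgebra.lift R (genImage (q := q) (v := v) (m := m)) (TF R n r) =
        heckeOf q (Umk R q v m n r) := FreeAlgebra.lift_ι_apply _ _
  cases h with
  | cyclo r h =>
    simp only [map_mul, map_sub, AlgHom.commutes, map_zero, hL, h]
    exact blobL1_cyclotomic hv
  | LL r s =>
    simp only [map_mul, hL]
    exact commute_blobL_blobL hv hm r s
  | quad r =>
    simp only [map_mul, map_sub, map_add, map_one, AlgHom.commutes, map_zero, hT]
    exact heckeOf_quadratic (Umk_mul_self r)
  | TLrel r =>
    simp only [map_mul, map_sub, map_add, map_one, AlgHom.commutes, hT, hL]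
    exact blobT_mul_blobL r
  | braid r s h =>
    simp only [map_mul, hT]
    exact heckeOf_braid (Umk_mul_self r) (Umk_mul_self s)
      (Umk_mul_Umk_mul_Umk r s (Or.inl h.symm)) (Umk_mul_Umk_mul_Umk s r (Or.inr h.symm))
  | TLcomm r s h =>
    simp only [map_mul, hT, hL]
    rw [← blobT_val]
    exact commute_blobT_blobL (by omega)
  | TT r s h =>
    simp only [map_mul, hT]
    exact commute_heckeOf (commute_heckeOf (commute_Umk_Umk r s h).symm).symm

/-- The homomorphism from the cyclotomic Hecke algebra to the blob algebra. -/
def heckeToBlob (hv : (v : R) = (q : R) - ((q⁻¹ : Rˣ) : R)) (hm : IsUnit (gaussR R q v m)) :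
    Hm R q m n →ₐ[R] Blob R q v m n :=
  RingQuot.liftAlgHom R ⟨FreeAlgebra.lift R genImage, lift_genImage_rel hv hm⟩

theorem heckeToBlob_Tmk (hv : (v : R) = (q : R) - ((q⁻¹ : Rˣ) : R))
    (hm : IsUnit (gaussR R q v m)) (i : Fin (n - 1)) :
    heckeToBlob hv hm (Tmk R q m n i) = heckeOf q (Umk R q v m n i) := by
  rw [heckeToBlob, Tmk, RingQuot.liftAlgHom_mkAlgHom_apply]
  exact FreeAlgebra.lift_ι_apply _ _

theorem heckeToBlob_Lmk (hv : (v : R) = (q : R) - ((q⁻¹ : Rˣ) : R))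
    (hm : IsUnit (gaussR R q v m)) (r : Fin n) :
    heckeToBlob hv hm (Lmk R q m n r) = blobL q v m n r := by
  rw [heckeToBlob, Lmk, RingQuot.liftAlgHom_mkAlgHom_apply]
  exact FreeAlgebra.lift_ι_apply _ _

end HeckeImages

section Generation

variable {R} {q v : Rˣ} {m : ℤ} {n : ℕ}

theorem Lmk_hi (r : Fin (n - 1)) :
    Lmk R q m n (hi r) = ((q⁻¹ : Rˣ) : R) ^ 2 •
      (Tmk R q m n r * Lmk R q m n (lo r) * Tmk R q m n r) := by
  have hTL : Tmk R q m n r * Lmk R q m n (lo r) =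
      Lmk R q m n (hi r) * (Tmk R q m n r - algebraMap R _ ((q : R) ^ 2) + 1) := by
    simpa only [Tmk, Lmk, map_mul, map_sub, map_add, map_one, AlgHom.commutes] using
      RingQuot.mkAlgHom_rel R (HRel.TLrel (q0 := (q : R) ^ 2) (l1 := ((q ^ m : Rˣ) : R))
        (l2 := ((q ^ (-m) : Rˣ) : R)) r)
  have hquad : (Tmk R q m n r + 1) * (Tmk R q m n r - algebraMap R _ ((q : R) ^ 2)) = 0 := by
    simpa only [Tmk, Lmk, map_mul, map_sub, map_add, map_one, map_zero, AlgHom.commutes] using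
      RingQuot.mkAlgHom_rel R (HRel.quad (q0 := (q : R) ^ 2) (l1 := ((q ^ m : Rˣ) : R))
        (l2 := ((q ^ (-m) : Rˣ) : R)) r)
  have hinv : (Tmk R q m n r - algebraMap R _ ((q : R) ^ 2) + 1) * Tmk R q m n r =
      algebraMap R _ ((q : R) ^ 2) := by
    have hc := Algebra.commutes ((q : R) ^ 2) (Tmk R q m n r)
    rw [← sub_eq_zero, ← hquad]
    simp only [add_mul, sub_mul, mul_sub, one_mul, hc]
    abel
  have hq : ((q⁻¹ : Rˣ) : R) ^ 2 * (q : R) ^ 2 = 1 := by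
    rw [← mul_pow, q.inv_mul, one_pow]
  rw [hTL, mul_assoc, hinv, Algebra.algebraMap_eq_smul_one, mul_smul_comm, smul_smul, hq,
    one_smul, mul_one]

theorem algHom_Hm_ext {B : Type*} [Semiring B] [Algebra R B] (hn : 1 ≤ n)
    {f g : Hm R q m n →ₐ[R] B} (hT : ∀ i, f (Tmk R q m n i) = g (Tmk R q m n i))
    (hL : f (Lmk R q m n ⟨0, hn⟩) = g (Lmk R q m n ⟨0, hn⟩)) : f = g := by
  have hLr (r : ℕ) (hr : r < n) : f (Lmk R q m n ⟨r, hr⟩) = g (Lmk R q m n ⟨r, hr⟩) := by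
    induction r with
    | zero => exact hL
    | succ r ih =>
      have hrec := Lmk_hi (R := R) (q := q) (m := m) (n := n) ⟨r, by omega⟩
      simp only [hi, lo] at hrec
      rw [hrec, map_smul, map_smul]
      simp only [map_mul, hT, ih (by omega)]
  apply RingQuot.ringQuot_ext'
  apply FreeAlgebra.hom_ext
  funext x
  cases x with
  | L r => exact hLr r r.2
  | T i => exact hT i

theorem subalgebra_Blob_eq_top {S : Subalgebra R (Blob R q v m n)}
    (he : emk R q v m n ∈ S) (hU : ∀ i, Umk R q v m n i ∈ S) : S = ⊤ := by
  refine Algebra.eq_top_iff.2 fun x => ?_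
  obtain ⟨y, rfl⟩ := RingQuot.mkAlgHom_surjective R (BlobRel R q v m n) x
  induction y using FreeAlgebra.induction with
  | grade0 r => rw [AlgHom.commutes]; exact S.algebraMap_mem r
  | grade1 x =>
    cases x with
    | e => exact he
    | U i => exact hU i
  | mul a b ha hb => rw [map_mul]; exact S.mul_mem ha hb
  | add a b ha hb => rw [map_add]; exact S.add_mem ha hb

theorem mem_of_unit_smul_add_algebraMap_mem {A : Type*} [Ring A] [Algebra R A]
    {S : Subalgebra R A} {a b : R} (ha : IsUnit a) {x : A}
    (h : a • x + algebraMap R A b ∈ S) : x ∈ S := by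
  obtain ⟨u, rfl⟩ := ha
  have hx : (u : R) • x ∈ S := by
    simpa using S.sub_mem h (S.algebraMap_mem b)
  simpa [smul_smul] using S.smul_mem hx ((u⁻¹ : Rˣ) : R)

theorem heckeToBlob_surjective (hv : (v : R) = (q : R) - ((q⁻¹ : Rˣ) : R))
    (hm : IsUnit (gaussR R q v m)) (hn : 1 ≤ n) :
    Function.Surjective (heckeToBlob (n := n) hv hm) := by
  rw [← AlgHom.range_eq_top]
  refine subalgebra_Blob_eq_top ?_ fun i => ?_
  · have h : blobL1 q v m n ∈ (heckeToBlob (n := n) hv hm).range :=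
      ⟨Lmk R q m n ⟨0, hn⟩, heckeToBlob_Lmk hv hm _⟩
    rw [blobL1, U0el, smul_smul] at h
    exact mem_of_unit_smul_add_algebraMap_mem ((hv ▸ v.isUnit).mul hm.neg) h
  · exact mem_of_unit_smul_add_algebraMap_mem q.isUnit
      ⟨Tmk R q m n i, heckeToBlob_Tmk hv hm i⟩

end Generation

/-- Over a commutative ring `R`, with `q` a unit such that `v = q - q⁻¹`
and `[m]` are units, there is a unique surjective `R`-algebra homomorphism
`Φ : H_n^R(q²; q^m, q^{-m}) → b_n^R(m)` with `Φ(T_i) = qU_i + q²` and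
`Φ(L₁) = (q - q⁻¹)U₀ + q^m`. -/
theorem statement8 (q v : Rˣ) (hv : (v : R) = (q : R) - ((q⁻¹ : Rˣ) : R))
    (m : ℤ) (hm : IsUnit (gaussR R q v m)) (n : ℕ) (hn : 1 ≤ n) :
    ∃ Φ : Hm R q m n →ₐ[R] Blob R q v m n,
      (∀ i : Fin (n - 1),
        Φ (Tmk R q m n i) = (q : R) • Umk R q v m n i + algebraMap R _ ((q : R) ^ 2)) ∧
      (Φ (Lmk R q m n ⟨0, by omega⟩) =
        ((q : R) - ((q⁻¹ : Rˣ) : R)) • U0el R q v m n +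
          algebraMap R _ (((q ^ m : Rˣ) : R))) ∧
      Function.Surjective Φ ∧
      (∀ Ψ : Hm R q m n →ₐ[R] Blob R q v m n,
        (∀ i : Fin (n - 1),
          Ψ (Tmk R q m n i) = (q : R) • Umk R q v m n i + algebraMap R _ ((q : R) ^ 2)) →
        (Ψ (Lmk R q m n ⟨0, by omega⟩) =
          ((q : R) - ((q⁻¹ : Rˣ) : R)) • U0el R q v m n +
            algebraMap R _ (((q ^ m : Rˣ) : R))) →
        Ψ = Φ) := by
  refine ⟨heckeToBlob hv hm, heckeToBlob_Tmk hv hm, heckeToBlob_Lmk hv hm _,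
    heckeToBlob_surjective hv hm hn, fun Ψ hT hL => algHom_Hm_ext hn (fun i => ?_) ?_⟩
  · rw [hT, heckeToBlob_Tmk, heckeOf]
  · rw [hL, heckeToBlob_Lmk]
    rfl

end Statement8
end
end

section
/- Let q, Q ∈ ℂ^× satisfy q⁴ ≠ 1, Q² ≠ 1, Q² ≠ q², and q²Q² ≠ 1. In the cyclotomic Hecke algebra H_2(q²; Q, Q^{−1}), set L_2 := q^{−2}T_1L_1T_1 and define e_2^{−1} := (T_1 − q²)(L_1 − Q^{−1})(L_2 − Q^{−1}) / ((1+q²)(Q − Q^{−1})(Q^{−1} − q^{−2}Q)) and e_2^{−2} := (T_1 − q²)(L_1 − Q)(L_2 − Q) / ((1+q²)(Q^{−1} − Q)(Q − q^{−2}Q^{−1})). Then e_2^{−1} and e_2^{−2} are idempotents and they satisfy: (T_1 + 1)e_2^{−1} = 0, (L_1 − Q)e_2^{−1} = 0, (L_2 − q^{−2}Q)e_2^{−1} = 0, (T_1 + 1)e_2^{−2} = 0, (L_1 − Q^{−1})e_2^{−2} = 0, and (L_2 − q^{−2}Q^{−1})e_2^{−2} = 0. -/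
noncomputable section

namespace Statement9

/-- Generators of the cyclotomic Hecke algebra of type `G(2,1,n)`:
`L_1, …, L_n` and `T_1, …, T_{n-1}` (0-indexed). -/
inductive HGen (n : ℕ) : Type
  | L : Fin n → HGen n
  | T : Fin (n - 1) → HGen n

/-- The generator `L_r` in the free algebra. -/
def LF (n : ℕ) (r : Fin n) : FreeAlgebra ℂ (HGen n) := FreeAlgebra.ι ℂ (HGen.L r)

/-- The generator `T_r` in the free algebra. -/
def TF (n : ℕ) (r : Fin (n - 1)) : FreeAlgebra ℂ (HGen n) := FreeAlgebra.ι ℂ (HGen.T r)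

/-- The position `r` as an element of `Fin n`. -/
def lo {n : ℕ} (r : Fin (n - 1)) : Fin n := ⟨r.val, by have := r.2; omega⟩

/-- The position `r + 1` as an element of `Fin n`. -/
def hi {n : ℕ} (r : Fin (n - 1)) : Fin n := ⟨r.val + 1, by have := r.2; omega⟩

/-- The defining relations of the cyclotomic Hecke algebra `H_n(q₀; λ₁, λ₂)` of type
`G(2,1,n)`. -/
inductive HRel (q0 l1 l2 : ℂ) (n : ℕ) :
    FreeAlgebra ℂ (HGen n) → FreeAlgebra ℂ (HGen n) → Prop
  | cyclo (r : Fin n) (h : r.val = 0) :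
      HRel q0 l1 l2 n
        ((LF n r - algebraMap ℂ _ l1) * (LF n r - algebraMap ℂ _ l2)) 0
  | LL (r s : Fin n) : HRel q0 l1 l2 n (LF n r * LF n s) (LF n s * LF n r)
  | quad (r : Fin (n - 1)) :
      HRel q0 l1 l2 n ((TF n r + 1) * (TF n r - algebraMap ℂ _ q0)) 0
  | TLrel (r : Fin (n - 1)) :
      HRel q0 l1 l2 n (TF n r * LF n (lo r))
        (LF n (hi r) * (TF n r - algebraMap ℂ _ q0 + 1))
  | braid (r s : Fin (n - 1)) (h : s.val = r.val + 1) :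
      HRel q0 l1 l2 n (TF n r * TF n s * TF n r) (TF n s * TF n r * TF n s)
  | TLcomm (r : Fin (n - 1)) (s : Fin n) (h : r.val + 1 < s.val ∨ s.val + 1 < r.val) :
      HRel q0 l1 l2 n (TF n r * LF n s) (LF n s * TF n r)
  | TT (r s : Fin (n - 1)) (h : r.val + 1 < s.val ∨ s.val + 1 < r.val) :
      HRel q0 l1 l2 n (TF n r * TF n s) (TF n s * TF n r)

/-- The cyclotomic Hecke algebra `H_n(q₀; λ₁, λ₂)` of type `G(2,1,n)`. -/
abbrev Hcy (q0 l1 l2 : ℂ) (n : ℕ) := RingQuot (HRel q0 l1 l2 n)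

/-- The image of `L_r` in the cyclotomic Hecke algebra. -/
def Lmk (q0 l1 l2 : ℂ) (n : ℕ) (r : Fin n) : Hcy q0 l1 l2 n :=
  RingQuot.mkAlgHom ℂ (HRel q0 l1 l2 n) (LF n r)

/-- The image of `T_r` in the cyclotomic Hecke algebra. -/
def Tmk (q0 l1 l2 : ℂ) (n : ℕ) (r : Fin (n - 1)) : Hcy q0 l1 l2 n :=
  RingQuot.mkAlgHom ℂ (HRel q0 l1 l2 n) (TF n r)

/-- The generator `T₁` of `H₂(q²; Q, Q⁻¹)`. -/
def T1 (q Q : ℂ) : Hcy (q ^ 2) Q Q⁻¹ 2 := Tmk (q ^ 2) Q Q⁻¹ 2 ⟨0, by omega⟩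

/-- The generator `L₁` of `H₂(q²; Q, Q⁻¹)`. -/
def L1 (q Q : ℂ) : Hcy (q ^ 2) Q Q⁻¹ 2 := Lmk (q ^ 2) Q Q⁻¹ 2 ⟨0, by omega⟩

/-- The element `L₂ := q⁻²T₁L₁T₁` of `H₂(q²; Q, Q⁻¹)`. -/
def L2 (q Q : ℂ) : Hcy (q ^ 2) Q Q⁻¹ 2 :=
  q ^ (-2 : ℤ) • (T1 q Q * L1 q Q * T1 q Q)

/-- The idempotent `e₂⁻¹ = (T₁-q²)(L₁-Q⁻¹)(L₂-Q⁻¹)/((1+q²)(Q-Q⁻¹)(Q⁻¹-q⁻²Q))`. -/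
def e21 (q Q : ℂ) : Hcy (q ^ 2) Q Q⁻¹ 2 :=
  ((1 + q ^ 2) * (Q - Q⁻¹) * (Q⁻¹ - q ^ (-2 : ℤ) * Q))⁻¹ •
    ((T1 q Q - algebraMap ℂ _ (q ^ 2)) * (L1 q Q - algebraMap ℂ _ Q⁻¹) *
      (L2 q Q - algebraMap ℂ _ Q⁻¹))

/-- The idempotent `e₂⁻² = (T₁-q²)(L₁-Q)(L₂-Q)/((1+q²)(Q⁻¹-Q)(Q-q⁻²Q⁻¹))`. -/
def e22 (q Q : ℂ) : Hcy (q ^ 2) Q Q⁻¹ 2 :=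
  ((1 + q ^ 2) * (Q⁻¹ - Q) * (Q - q ^ (-2 : ℤ) * Q⁻¹))⁻¹ •
    ((T1 q Q - algebraMap ℂ _ (q ^ 2)) * (L1 q Q - algebraMap ℂ _ Q) *
      (L2 q Q - algebraMap ℂ _ Q))

section Abstract

variable {A : Type*} [Ring A] [Algebra ℂ A]

/-- In a quadratic algebra with `M = u⁻¹ T L T`, the element `(L - b)(M - b)` commutes
with `T`. -/
theorem commute_shifted_mul {T L M : A} {u : ℂ} (b : ℂ) (hu : u ≠ 0)
    (hT : (T + 1) * (T - algebraMap ℂ A u) = 0) (hM : M = u⁻¹ • (T * L * T))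
    (hLM : L * M = M * L) :
    Commute T ((L - algebraMap ℂ A b) * (M - algebraMap ℂ A b)) := by
  have hTT : T * T = (u - 1) • T + u • (1 : A) := by
    rw [Algebra.algebraMap_eq_smul_one] at hT
    simp only [mul_sub, add_mul, one_mul, mul_smul_comm, mul_one] at hT
    linear_combination (norm := module) hT
  have hTM : T * M = (u - 1) • M + L * T := by
    have h : T * M = u⁻¹ • (T * T * L * T) := by
      rw [hM, mul_smul_comm]; simp only [mul_assoc]
    rw [h, hTT, hM]
    simp only [add_mul, smul_mul_assoc, one_mul, smul_add, smul_smul]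
    rw [inv_mul_cancel₀ hu, one_smul, mul_comm u⁻¹]
  have hMT : M * T = (u - 1) • M + T * L := by
    have h : M * T = u⁻¹ • (T * L * (T * T)) := by
      rw [hM, smul_mul_assoc]; simp only [mul_assoc]
    rw [h, hTT, hM]
    simp only [mul_add, mul_smul_comm, mul_one, smul_add, smul_smul]
    rw [inv_mul_cancel₀ hu, one_smul, mul_comm u⁻¹]
  have hsum : Commute T (L + M) := by
    rw [Commute, SemiconjBy, mul_add, add_mul, hTM, hMT]
    abel
  have hprod : Commute T (L * M) := by
    have hTL : T * L = M * T - (u - 1) • M := by rw [hMT]; abel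
    rw [Commute, SemiconjBy, ← mul_assoc, hTL, sub_mul, mul_assoc, hTM, mul_add, ← mul_assoc,
      smul_mul_assoc, mul_smul_comm, hLM]
    abel
  have hexpand : (L - algebraMap ℂ A b) * (M - algebraMap ℂ A b) =
      L * M - b • (L + M) + algebraMap ℂ A (b * b) := by
    simp only [Algebra.algebraMap_eq_smul_one, mul_sub, sub_mul, smul_mul_assoc, mul_smul_comm,
      one_mul, mul_one]
    module
  rw [hexpand]
  exact (hprod.sub_right (hsum.smul_right b)).add_right (Algebra.commute_algebraMap_right _ _)

/-- The one-dimensional idempotent attached to the eigenvalues `-1` of `T` and `a` of `L`. -/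
theorem idempotent_and_eigenvalues {T L M e : A} {u a b : ℂ} (hu : u ≠ 0)
    (hL : (L - algebraMap ℂ A a) * (L - algebraMap ℂ A b) = 0)
    (hT : (T + 1) * (T - algebraMap ℂ A u) = 0) (hM : M = u⁻¹ • (T * L * T))
    (hLM : L * M = M * L) (hc : (1 + u) * (a - b) * (b - u⁻¹ * a) ≠ 0)
    (he : e = ((1 + u) * (a - b) * (b - u⁻¹ * a))⁻¹ •
      ((T - algebraMap ℂ A u) * (L - algebraMap ℂ A b) * (M - algebraMap ℂ A b))) :
    e * e = e ∧ (T + 1) * e = 0 ∧ (L - algebraMap ℂ A a) * e = 0 ∧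
      (M - algebraMap ℂ A (u⁻¹ * a)) * e = 0 := by
  have hcomm := commute_shifted_mul b hu hT hM hLM
  set P := (L - algebraMap ℂ A b) * (M - algebraMap ℂ A b) with hP
  have heP : e = ((1 + u) * (a - b) * (b - u⁻¹ * a))⁻¹ • (P * (T - algebraMap ℂ A u)) := by
    rw [he, mul_assoc (T - _), ← hP, (hcomm.sub_left (Algebra.commute_algebraMap_left u P)).eq]
  have hTe : (T + 1) * e = 0 := by
    rw [he, mul_smul_comm, ← mul_assoc, ← mul_assoc, hT, zero_mul, zero_mul, smul_zero]
  have hLe : (L - algebraMap ℂ A a) * e = 0 := by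
    rw [heP, mul_smul_comm, hP, ← mul_assoc, ← mul_assoc, hL, zero_mul, zero_mul, smul_zero]
  have hTe' : T * e = -e := by
    rw [add_mul, one_mul] at hTe
    exact eq_neg_of_add_eq_zero_left hTe
  have hLe' : L * e = a • e := by
    rwa [sub_mul, sub_eq_zero, ← Algebra.smul_def] at hLe
  have hMe' : M * e = (u⁻¹ * a) • e := by
    rw [hM, smul_mul_assoc, mul_assoc, hTe', mul_assoc, mul_neg, hLe', mul_neg, mul_smul_comm,
      hTe']
    module
  refine ⟨?_, hTe, hLe, ?_⟩
  · have hPe : P * ((T - algebraMap ℂ A u) * e) =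
        ((1 + u) * (a - b) * (b - u⁻¹ * a)) • e := by
      rw [hP, sub_mul T, hTe', ← Algebra.smul_def, mul_assoc, mul_sub, mul_neg, sub_mul M, hMe',
        ← Algebra.smul_def, mul_smul_comm, sub_mul M, hMe', ← Algebra.smul_def, sub_mul L]
      simp only [← Algebra.smul_def, mul_sub, mul_neg, mul_smul_comm, hLe']
      module
    nth_rewrite 1 [heP]
    rw [smul_mul_assoc, mul_assoc P, hPe, smul_smul, inv_mul_cancel₀ hc, one_smul]
  · rw [sub_mul, hMe', ← Algebra.smul_def, sub_self]

end Abstract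

theorem L1_quadratic (q Q : ℂ) :
    (L1 q Q - algebraMap ℂ _ Q) * (L1 q Q - algebraMap ℂ _ Q⁻¹) = 0 := by
  simpa [L1, Lmk] using
    RingQuot.mkAlgHom_rel ℂ (HRel.cyclo (q0 := q ^ 2) (l1 := Q) (l2 := Q⁻¹) (n := 2) 0 rfl)

theorem T1_quadratic (q Q : ℂ) :
    (T1 q Q + 1) * (T1 q Q - algebraMap ℂ _ (q ^ 2)) = 0 := by
  have h := RingQuot.mkAlgHom_rel ℂ
    (HRel.quad (q0 := q ^ 2) (l1 := Q) (l2 := Q⁻¹) (n := 2) ⟨0, by omega⟩)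
  rwa [map_mul, map_add, map_sub, map_one, map_zero, AlgHom.commutes] at h

/-- The element `q⁻²T₁L₁T₁` is the second Jucys–Murphy generator. -/
theorem L2_eq_Lmk {q : ℂ} (hq : q ≠ 0) (Q : ℂ) :
    L2 q Q = Lmk (q ^ 2) Q Q⁻¹ 2 ⟨1, by omega⟩ := by
  have h := RingQuot.mkAlgHom_rel ℂ
    (HRel.TLrel (q0 := q ^ 2) (l1 := Q) (l2 := Q⁻¹) (n := 2) ⟨0, by omega⟩)
  rw [map_mul, map_mul, map_add, map_sub, map_one, AlgHom.commutes] at h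
  change T1 q Q * L1 q Q = Lmk (q ^ 2) Q Q⁻¹ 2 ⟨1, by omega⟩ *
    (T1 q Q - algebraMap ℂ _ (q ^ 2) + 1) at h
  have hT : (T1 q Q - algebraMap ℂ _ (q ^ 2) + 1) * T1 q Q = algebraMap ℂ _ (q ^ 2) := by
    have h0 := T1_quadratic q Q
    have hc := Algebra.commutes (q ^ 2) (T1 q Q)
    rw [add_mul, one_mul, mul_sub, ← hc] at h0
    rw [add_mul, one_mul, sub_mul, ← sub_eq_zero, ← h0]
    abel
  rw [L2, h, mul_assoc, hT, ← Algebra.commutes, ← Algebra.smul_def, smul_smul, zpow_neg,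
    zpow_ofNat, inv_mul_cancel₀ (pow_ne_zero 2 hq), one_smul]

theorem L1_mul_L2 {q : ℂ} (hq : q ≠ 0) (Q : ℂ) : L1 q Q * L2 q Q = L2 q Q * L1 q Q := by
  have h := RingQuot.mkAlgHom_rel ℂ
    (HRel.LL (q0 := q ^ 2) (l1 := Q) (l2 := Q⁻¹) (n := 2) ⟨0, by omega⟩ ⟨1, by omega⟩)
  rw [map_mul, map_mul] at h
  rw [L2_eq_Lmk hq]
  exact h

/-- Under the separation conditions on `q` and `Q`, the elements `e₂⁻¹` and
`e₂⁻²` of `H₂(q²; Q, Q⁻¹)` are idempotents and satisfy the listed annihilation equations. -/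
theorem statement9 (q Q : ℂ) (hq : q ≠ 0) (hQ : Q ≠ 0)
    (h4 : q ^ 4 ≠ 1) (h1 : Q ^ 2 ≠ 1) (h2 : Q ^ 2 ≠ q ^ 2) (h3 : q ^ 2 * Q ^ 2 ≠ 1) :
    e21 q Q * e21 q Q = e21 q Q ∧
    e22 q Q * e22 q Q = e22 q Q ∧
    (T1 q Q + 1) * e21 q Q = 0 ∧
    (L1 q Q - algebraMap ℂ _ Q) * e21 q Q = 0 ∧
    (L2 q Q - algebraMap ℂ _ (q ^ (-2 : ℤ) * Q)) * e21 q Q = 0 ∧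
    (T1 q Q + 1) * e22 q Q = 0 ∧
    (L1 q Q - algebraMap ℂ _ Q⁻¹) * e22 q Q = 0 ∧
    (L2 q Q - algebraMap ℂ _ (q ^ (-2 : ℤ) * Q⁻¹)) * e22 q Q = 0 := by
  have hu : q ^ 2 ≠ 0 := pow_ne_zero 2 hq
  have hz : q ^ (-2 : ℤ) = (q ^ 2)⁻¹ := by rw [zpow_neg, zpow_ofNat]
  have hplus : 1 + q ^ 2 ≠ 0 := fun h => h4 (by linear_combination (q ^ 2 - 1) * h)
  have hdiff : Q - Q⁻¹ ≠ 0 := fun h => h1 (by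
    field_simp at h
    linear_combination h)
  have hsep1 : Q⁻¹ - (q ^ 2)⁻¹ * Q ≠ 0 := fun h => h2 (by
    field_simp at h
    linear_combination -h)
  have hsep2 : Q - (q ^ 2)⁻¹ * Q⁻¹ ≠ 0 := fun h => h3 (by
    field_simp at h
    linear_combination h)
  have hM : L2 q Q = (q ^ 2)⁻¹ • (T1 q Q * L1 q Q * T1 q Q) := by rw [L2, hz]
  have hL := L1_quadratic q Q
  have hL' : (L1 q Q - algebraMap ℂ _ Q⁻¹) * (L1 q Q - algebraMap ℂ _ Q) = 0 := by
    rw [← hL]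
    exact (((Commute.refl (L1 q Q)).sub_left (Algebra.commute_algebraMap_left _ _)).sub_right
      (Algebra.commute_algebraMap_right _ _)).eq
  obtain ⟨i1, t1, l1, m1⟩ := idempotent_and_eigenvalues (e := e21 q Q) hu hL (T1_quadratic q Q) hM
    (L1_mul_L2 hq Q) (mul_ne_zero (mul_ne_zero hplus hdiff) hsep1) (by rw [e21, hz])
  obtain ⟨i2, t2, l2, m2⟩ := idempotent_and_eigenvalues (e := e22 q Q) hu hL' (T1_quadratic q Q) hM
    (L1_mul_L2 hq Q) (mul_ne_zero (mul_ne_zero hplus (sub_ne_zero.mpr (sub_ne_zero.mp hdiff).symm))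
      hsep2) (by rw [e22, hz])
  rw [hz]
  exact ⟨i1, i2, t1, l1, m1, t2, l2, m2⟩

end Statement9
end
end

section
/- Let q, Q ∈ ℂ^× satisfy q⁴ ≠ 1, Q² ≠ 1, Q² ≠ q², and q²Q² ≠ 1, and let e_2^{−1} := (T_1 − q²)(L_1 − Q^{−1})(L_2 − Q^{−1}) / ((1+q²)(Q − Q^{−1})(Q^{−1} − q^{−2}Q)) ∈ H_2(q²; Q, Q^{−1}), where L_2 := q^{−2}T_1L_1T_1. Then e_2^{−1} is the unique nonzero idempotent f of H_2(q²; Q, Q^{−1}) satisfying (T_1 + 1)f = 0 and (L_1 − Q)f = 0. -/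
noncomputable section

namespace Statement10

/-- Generators of the cyclotomic Hecke algebra of type `G(2,1,n)`:
`L_1, …, L_n` and `T_1, …, T_{n-1}` (0-indexed). -/
inductive HGen (n : ℕ) : Type
  | L : Fin n → HGen n
  | T : Fin (n - 1) → HGen n

/-- The generator `L_r` in the free algebra. -/
def LF (n : ℕ) (r : Fin n) : FreeAlgebra ℂ (HGen n) := FreeAlgebra.ι ℂ (HGen.L r)

/-- The generator `T_r` in the free algebra. -/
def TF (n : ℕ) (r : Fin (n - 1)) : FreeAlgebra ℂ (HGen n) := FreeAlgebra.ι ℂ (HGen.T r)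

/-- The position `r` as an element of `Fin n`. -/
def lo {n : ℕ} (r : Fin (n - 1)) : Fin n := ⟨r.val, by have := r.2; omega⟩

/-- The position `r + 1` as an element of `Fin n`. -/
def hi {n : ℕ} (r : Fin (n - 1)) : Fin n := ⟨r.val + 1, by have := r.2; omega⟩

/-- The defining relations of the cyclotomic Hecke algebra `H_n(q₀; λ₁, λ₂)` of type
`G(2,1,n)`. -/
inductive HRel (q0 l1 l2 : ℂ) (n : ℕ) :
    FreeAlgebra ℂ (HGen n) → FreeAlgebra ℂ (HGen n) → Prop
  | cyclo (r : Fin n) (h : r.val = 0) :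
      HRel q0 l1 l2 n
        ((LF n r - algebraMap ℂ _ l1) * (LF n r - algebraMap ℂ _ l2)) 0
  | LL (r s : Fin n) : HRel q0 l1 l2 n (LF n r * LF n s) (LF n s * LF n r)
  | quad (r : Fin (n - 1)) :
      HRel q0 l1 l2 n ((TF n r + 1) * (TF n r - algebraMap ℂ _ q0)) 0
  | TLrel (r : Fin (n - 1)) :
      HRel q0 l1 l2 n (TF n r * LF n (lo r))
        (LF n (hi r) * (TF n r - algebraMap ℂ _ q0 + 1))
  | braid (r s : Fin (n - 1)) (h : s.val = r.val + 1) :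
      HRel q0 l1 l2 n (TF n r * TF n s * TF n r) (TF n s * TF n r * TF n s)
  | TLcomm (r : Fin (n - 1)) (s : Fin n) (h : r.val + 1 < s.val ∨ s.val + 1 < r.val) :
      HRel q0 l1 l2 n (TF n r * LF n s) (LF n s * TF n r)
  | TT (r s : Fin (n - 1)) (h : r.val + 1 < s.val ∨ s.val + 1 < r.val) :
      HRel q0 l1 l2 n (TF n r * TF n s) (TF n s * TF n r)

/-- The cyclotomic Hecke algebra `H_n(q₀; λ₁, λ₂)` of type `G(2,1,n)`. -/
abbrev Hcy (q0 l1 l2 : ℂ) (n : ℕ) := RingQuot (HRel q0 l1 l2 n)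

/-- The image of `L_r` in the cyclotomic Hecke algebra. -/
def Lmk (q0 l1 l2 : ℂ) (n : ℕ) (r : Fin n) : Hcy q0 l1 l2 n :=
  RingQuot.mkAlgHom ℂ (HRel q0 l1 l2 n) (LF n r)

/-- The image of `T_r` in the cyclotomic Hecke algebra. -/
def Tmk (q0 l1 l2 : ℂ) (n : ℕ) (r : Fin (n - 1)) : Hcy q0 l1 l2 n :=
  RingQuot.mkAlgHom ℂ (HRel q0 l1 l2 n) (TF n r)

/-- The generator `T₁` of `H₂(q²; Q, Q⁻¹)`. -/
def T1 (q Q : ℂ) : Hcy (q ^ 2) Q Q⁻¹ 2 := Tmk (q ^ 2) Q Q⁻¹ 2 ⟨0, by omega⟩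

/-- The generator `L₁` of `H₂(q²; Q, Q⁻¹)`. -/
def L1 (q Q : ℂ) : Hcy (q ^ 2) Q Q⁻¹ 2 := Lmk (q ^ 2) Q Q⁻¹ 2 ⟨0, by omega⟩

/-- The element `L₂ := q⁻²T₁L₁T₁` of `H₂(q²; Q, Q⁻¹)`. -/
def L2 (q Q : ℂ) : Hcy (q ^ 2) Q Q⁻¹ 2 :=
  q ^ (-2 : ℤ) • (T1 q Q * L1 q Q * T1 q Q)

/-- The idempotent `e₂⁻¹ = (T₁-q²)(L₁-Q⁻¹)(L₂-Q⁻¹)/((1+q²)(Q-Q⁻¹)(Q⁻¹-q⁻²Q))`. -/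
def e21 (q Q : ℂ) : Hcy (q ^ 2) Q Q⁻¹ 2 :=
  ((1 + q ^ 2) * (Q - Q⁻¹) * (Q⁻¹ - q ^ (-2 : ℤ) * Q))⁻¹ •
    ((T1 q Q - algebraMap ℂ _ (q ^ 2)) * (L1 q Q - algebraMap ℂ _ Q⁻¹) *
      (L2 q Q - algebraMap ℂ _ Q⁻¹))

section Abstract

variable {A : Type*} [Ring A] [Algebra ℂ A] {T L M : A} {p : ℂ}

/-- The quadratic relation, solved for `T²`. -/
lemma mul_self_of_quad (hT : (T + 1) * (T - algebraMap ℂ A p) = 0) :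
    T * T = (p - 1) • T + p • (1 : A) := by
  have h : T * T - ((p - 1) • T + p • (1 : A)) = (T + 1) * (T - algebraMap ℂ A p) := by
    simp only [Algebra.algebraMap_eq_smul_one, add_mul, mul_sub, mul_smul_comm, mul_one, one_mul]
    module
  rw [← sub_eq_zero, h, hT]

/-- `M` is determined by `T` and `L`. -/
lemma conj_eq_smul (hT : T * T = (p - 1) • T + p • (1 : A))
    (hTL : T * L = M * (T - algebraMap ℂ A p + 1)) : T * L * T = p • M := by
  rw [hTL, mul_assoc]
  simp only [Algebra.algebraMap_eq_smul_one, add_mul, sub_mul, smul_mul_assoc, one_mul, hT,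
    mul_add, mul_sub, mul_smul_comm, mul_one]
  module

lemma mul_eq_of_rel (hTL : T * L = M * (T - algebraMap ℂ A p + 1)) :
    T * L = M * T - (p - 1) • M := by
  rw [hTL]
  simp only [Algebra.algebraMap_eq_smul_one, mul_add, mul_sub, mul_smul_comm, mul_one]
  module

lemma mul_conj_eq (hp : p ≠ 0) (hT : T * T = (p - 1) • T + p • (1 : A))
    (hM : T * L * T = p • M) : T * M = L * T + (p - 1) • M := by
  have h : p • (T * M) = p • (L * T + (p - 1) • M) := by
    rw [← mul_smul_comm, ← hM, ← mul_assoc, ← mul_assoc, hT]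
    simp only [add_mul, smul_mul_assoc, one_mul, hM]
    module
  have := congrArg (fun x => p⁻¹ • x) h
  simpa only [inv_smul_smul₀ hp] using this

/-- Symmetric expressions in the Jucys–Murphy elements `L`, `M` commute with `T`. -/
lemma commute_symm (hLM : L * M = M * L) (hTL : T * L = M * T - (p - 1) • M)
    (hTM : T * M = L * T + (p - 1) • M) (a : ℂ) :
    Commute T ((L - algebraMap ℂ A a) * (M - algebraMap ℂ A a)) := by
  have hTLM : T * (L * M) = L * M * T := by
    rw [← mul_assoc, hTL, sub_mul, mul_assoc, hTM]
    simp only [mul_add, mul_smul_comm, smul_mul_assoc, ← mul_assoc, hLM]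
    abel
  have hz : (L - algebraMap ℂ A a) * (M - algebraMap ℂ A a)
      = L * M - a • (L + M) + (a * a) • (1 : A) := by
    simp only [Algebra.algebraMap_eq_smul_one, mul_sub, sub_mul, mul_smul_comm, smul_mul_assoc,
      mul_one, one_mul]
    module
  rw [hz, commute_iff_eq]
  simp only [mul_add, mul_sub, add_mul, sub_mul, mul_smul_comm, smul_mul_assoc, mul_one, one_mul,
    hTLM, hTL, hTM]
  module

lemma sub_algebraMap_mul {x f : A} {a b : ℂ} (h : x * f = a • f) :
    (x - algebraMap ℂ A b) * f = (a - b) • f := by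
  rw [sub_mul, h, ← Algebra.smul_def, sub_smul]

lemma mul_eq_smul_of_sub_mul {x f : A} {a : ℂ} (h : (x - algebraMap ℂ A a) * f = 0) :
    x * f = a • f := by
  rwa [sub_mul, ← Algebra.smul_def, sub_eq_zero] at h

lemma mul_eq_neg_one_smul {x f : A} (h : (x + 1) * f = 0) : x * f = (-1 : ℂ) • f := by
  rw [add_mul, one_mul] at h
  rw [neg_one_smul, eq_neg_of_add_eq_zero_left h]

lemma mul_eq_smul_of_mul_sub {x f : A} {a : ℂ} (h : f * (x - algebraMap ℂ A a) = 0) :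
    f * x = a • f := by
  rwa [mul_sub, ← Algebra.commutes, ← Algebra.smul_def, sub_eq_zero] at h

lemma mul_eq_neg_one_smul' {x f : A} (h : f * (x + 1) = 0) : f * x = (-1 : ℂ) • f := by
  rw [mul_add, mul_one] at h
  rw [neg_one_smul, eq_neg_of_add_eq_zero_left h]

lemma commute_sub_algebraMap {x y : A} (h : Commute x y) (a b : ℂ) :
    Commute (x - algebraMap ℂ A a) (y - algebraMap ℂ A b) :=
  (h.sub_left (Algebra.commute_algebraMap_left a y)).sub_right
    (Algebra.commute_algebraMap_right b _)

end Abstract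

section Relations

variable (q Q : ℂ)

/-- The generator `L_2` of the presentation. -/
def L2gen : Hcy (q ^ 2) Q Q⁻¹ 2 := Lmk (q ^ 2) Q Q⁻¹ 2 ⟨1, by omega⟩

lemma T1_quad : (T1 q Q + 1) * (T1 q Q - algebraMap ℂ _ (q ^ 2)) = 0 := by
  simpa [T1, Tmk, -map_pow] using RingQuot.mkAlgHom_rel ℂ (HRel.quad (q0 := q ^ 2) (l1 := Q) (l2 := Q⁻¹)
    (n := 2) ⟨0, by omega⟩)

lemma L1_cyclo : (L1 q Q - algebraMap ℂ _ Q) * (L1 q Q - algebraMap ℂ _ Q⁻¹) = 0 := by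
  simpa [L1, Lmk] using RingQuot.mkAlgHom_rel ℂ (HRel.cyclo (q0 := q ^ 2) (l1 := Q) (l2 := Q⁻¹)
    (n := 2) ⟨0, by omega⟩ rfl)

lemma L1_mul_L2gen : L1 q Q * L2gen q Q = L2gen q Q * L1 q Q := by
  simpa [L1, L2gen, Lmk] using RingQuot.mkAlgHom_rel ℂ (HRel.LL (q0 := q ^ 2) (l1 := Q)
    (l2 := Q⁻¹) (n := 2) ⟨0, by omega⟩ ⟨1, by omega⟩)

lemma T1_mul_L1 :
    T1 q Q * L1 q Q = L2gen q Q * (T1 q Q - algebraMap ℂ _ (q ^ 2) + 1) := by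
  simpa [T1, L1, L2gen, Lmk, Tmk, lo, hi, -map_pow] using RingQuot.mkAlgHom_rel ℂ
    (HRel.TLrel (q0 := q ^ 2) (l1 := Q) (l2 := Q⁻¹) (n := 2) ⟨0, by omega⟩)

variable {q}

lemma L2_eq_L2gen (hq : q ≠ 0) : L2 q Q = L2gen q Q := by
  rw [L2, conj_eq_smul (mul_self_of_quad (T1_quad q Q)) (T1_mul_L1 q Q), smul_smul]
  have : q ^ (-2 : ℤ) * q ^ 2 = 1 := by
    rw [zpow_neg]; exact inv_mul_cancel₀ (pow_ne_zero 2 hq)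
  rw [this, one_smul]

/-- The values on the generators of the one-dimensional representation on which `T₁` acts by `-1`
and `L₁` by `Q`. -/
def charVal (q Q : ℂ) : HGen 2 → ℂ
  | HGen.L r => if r.val = 0 then Q else q ^ (-2 : ℤ) * Q
  | HGen.T _ => -1

/-- The one-dimensional representation on which `T₁` acts by `-1` and `L₁` by `Q`. -/
def char (hq : q ≠ 0) : Hcy (q ^ 2) Q Q⁻¹ 2 →ₐ[ℂ] ℂ :=
  RingQuot.liftAlgHom ℂ ⟨FreeAlgebra.lift ℂ (charVal q Q), by
    intro x y h
    cases h with
    | cyclo r h => simp [LF, charVal, h]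
    | LL r s => simp [mul_comm]
    | quad r => simp [TF, charVal]
    | TLrel r =>
      simp [TF, LF, charVal, lo, hi]
      field_simp
      ring
    | braid r s h => exact absurd h (by have := r.2; have := s.2; omega)
    | TLcomm r s h => simp [mul_comm]
    | TT r s h => simp [mul_comm]⟩

lemma char_mk (hq : q ≠ 0) (x : FreeAlgebra ℂ (HGen 2)) :
    char Q hq (RingQuot.mkAlgHom ℂ _ x) = FreeAlgebra.lift ℂ (charVal q Q) x := by
  simp [char]

lemma char_T1 (hq : q ≠ 0) : char Q hq (T1 q Q) = -1 := by
  simp [T1, Tmk, char_mk, TF, charVal]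

lemma char_L1 (hq : q ≠ 0) : char Q hq (L1 q Q) = Q := by
  simp [L1, Lmk, char_mk, LF, charVal]

lemma L2gen_eq_smul (hq : q ≠ 0) :
    L2gen q Q = q ^ (-2 : ℤ) • (T1 q Q * L1 q Q * T1 q Q) := (L2_eq_L2gen Q hq).symm

/-- A right eigenvector for `T₁` and `L₁` is a right eigenvector for the whole algebra. -/
lemma mul_eq_char_smul (hq : q ≠ 0) {e : Hcy (q ^ 2) Q Q⁻¹ 2}
    (hT : e * T1 q Q = (-1 : ℂ) • e) (hL : e * L1 q Q = Q • e) (x : Hcy (q ^ 2) Q Q⁻¹ 2) :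
    e * x = char Q hq x • e := by
  obtain ⟨x, rfl⟩ := RingQuot.mkAlgHom_surjective ℂ _ x
  induction x using FreeAlgebra.induction with
  | grade0 r => rw [AlgHom.commutes, AlgHom.commutes, ← Algebra.commutes, Algebra.smul_def]; rfl
  | grade1 g =>
    cases g with
    | L r =>
      fin_cases r
      · change e * L1 q Q = char Q hq (L1 q Q) • e
        rw [hL, char_L1]
      · change e * L2gen q Q = char Q hq (L2gen q Q) • e
        rw [L2gen_eq_smul Q hq, map_smul, map_mul, map_mul, char_T1, char_L1, mul_smul_comm,
          ← mul_assoc, ← mul_assoc, hT, smul_mul_assoc, hL, smul_mul_assoc, smul_mul_assoc, hT,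
          smul_smul, smul_smul, smul_smul, smul_eq_mul]
        congr 1
        ring
    | T r =>
      fin_cases r
      change e * T1 q Q = char Q hq (T1 q Q) • e
      rw [hT, char_T1]
  | mul a b ha hb => rw [map_mul, map_mul, ← mul_assoc, ha, smul_mul_assoc, hb, smul_smul]
  | add a b ha hb => rw [map_add, map_add, mul_add, ha, hb, add_smul]

end Relations

section Idempotent

variable {q Q : ℂ}

lemma e21_denom_ne_zero (hq : q ≠ 0) (hQ : Q ≠ 0) (h4 : q ^ 4 ≠ 1) (h1 : Q ^ 2 ≠ 1)
    (h2 : Q ^ 2 ≠ q ^ 2) : (1 + q ^ 2) * (Q - Q⁻¹) * (Q⁻¹ - q ^ (-2 : ℤ) * Q) ≠ 0 := by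
  refine mul_ne_zero (mul_ne_zero ?_ ?_) ?_
  · intro h
    exact h4 (by linear_combination (q ^ 2 - 1) * h)
  · intro h
    field_simp at h
    exact h1 (by linear_combination h)
  · intro h
    rw [zpow_neg, zpow_ofNat] at h
    field_simp at h
    exact h2 (by linear_combination -h)

/-- `e21` acts as the identity on common eigenvectors of `T₁` and `L₁` for `-1` and `Q`. -/
lemma e21_mul (hd : (1 + q ^ 2) * (Q - Q⁻¹) * (Q⁻¹ - q ^ (-2 : ℤ) * Q) ≠ 0)
    {f : Hcy (q ^ 2) Q Q⁻¹ 2} (hT : T1 q Q * f = (-1 : ℂ) • f) (hL : L1 q Q * f = Q • f) :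
    e21 q Q * f = f := by
  have hM : L2 q Q * f = (q ^ (-2 : ℤ) * Q) • f := by
    rw [L2, smul_mul_assoc, mul_assoc, hT, mul_assoc, mul_smul_comm, hL, mul_smul_comm,
      mul_smul_comm, hT, smul_smul, smul_smul, smul_smul]
    congr 1
    ring
  rw [e21, smul_mul_assoc, mul_assoc (_ * _), sub_algebraMap_mul hM, mul_smul_comm,
    mul_assoc (T1 q Q - _), sub_algebraMap_mul hL, mul_smul_comm, sub_algebraMap_mul hT,
    smul_smul, smul_smul, smul_smul]
  convert one_smul ℂ f using 2
  rw [mul_assoc, mul_assoc, inv_mul_eq_iff_eq_mul₀ hd]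
  ring

lemma commute_T1_symm (hq : q ≠ 0) : Commute (T1 q Q)
    ((L1 q Q - algebraMap ℂ _ Q⁻¹) * (L2 q Q - algebraMap ℂ _ Q⁻¹)) := by
  have hT := mul_self_of_quad (T1_quad q Q)
  rw [L2_eq_L2gen Q hq]
  exact commute_symm (L1_mul_L2gen q Q) (mul_eq_of_rel (T1_mul_L1 q Q))
    (mul_conj_eq (pow_ne_zero 2 hq) hT (conj_eq_smul hT (T1_mul_L1 q Q))) _

lemma T1_add_one_mul_e21 : (T1 q Q + 1) * e21 q Q = 0 := by
  rw [e21, mul_smul_comm, ← mul_assoc, ← mul_assoc, T1_quad, zero_mul, zero_mul, smul_zero]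

lemma L1_mul_symm : (L1 q Q - algebraMap ℂ _ Q) *
    ((L1 q Q - algebraMap ℂ _ Q⁻¹) * (L2 q Q - algebraMap ℂ _ Q⁻¹)) = 0 := by
  rw [← mul_assoc, L1_cyclo, zero_mul]

lemma e21_eq_symm_mul (hq : q ≠ 0) :
    e21 q Q = ((1 + q ^ 2) * (Q - Q⁻¹) * (Q⁻¹ - q ^ (-2 : ℤ) * Q))⁻¹ •
      ((L1 q Q - algebraMap ℂ _ Q⁻¹) * (L2 q Q - algebraMap ℂ _ Q⁻¹) *
        (T1 q Q - algebraMap ℂ _ (q ^ 2))) := by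
  rw [e21, mul_assoc (T1 q Q - _),
    ((commute_T1_symm hq).sub_left (Algebra.commute_algebraMap_left (q ^ 2) _)).eq]

lemma L1_sub_mul_e21 (hq : q ≠ 0) : (L1 q Q - algebraMap ℂ _ Q) * e21 q Q = 0 := by
  rw [e21_eq_symm_mul hq, mul_smul_comm, ← mul_assoc _ _ (T1 q Q - _), L1_mul_symm, zero_mul,
    smul_zero]

lemma e21_mul_T1 (hq : q ≠ 0) : e21 q Q * T1 q Q = (-1 : ℂ) • e21 q Q := by
  have h : (T1 q Q - algebraMap ℂ _ (q ^ 2)) * (T1 q Q + 1) = 0 := by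
    rw [← T1_quad q Q]
    exact ((Commute.refl _).add_right (Commute.one_right _)).sub_left (Algebra.commutes _ _)
  have : e21 q Q * (T1 q Q + 1) = 0 := by
    rw [e21_eq_symm_mul hq, smul_mul_assoc, mul_assoc _ (T1 q Q - _), h, mul_zero, smul_zero]
  exact mul_eq_neg_one_smul' this

lemma e21_mul_L1 (hq : q ≠ 0) : e21 q Q * L1 q Q = Q • e21 q Q := by
  have hLM : Commute (L1 q Q) (L2 q Q) := by
    rw [L2_eq_L2gen Q hq]; exact L1_mul_L2gen q Q
  have hz : Commute (L1 q Q - algebraMap ℂ _ Q)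
      ((L1 q Q - algebraMap ℂ _ Q⁻¹) * (L2 q Q - algebraMap ℂ _ Q⁻¹)) :=
    (commute_sub_algebraMap (Commute.refl _) _ _).mul_right (commute_sub_algebraMap hLM _ _)
  have : e21 q Q * (L1 q Q - algebraMap ℂ _ Q) = 0 := by
    rw [e21, smul_mul_assoc, mul_assoc (T1 q Q - _), mul_assoc (T1 q Q - _), ← hz.eq,
      L1_mul_symm, mul_zero, smul_zero]
  exact mul_eq_smul_of_mul_sub this

lemma char_e21 (hq : q ≠ 0) (hd : (1 + q ^ 2) * (Q - Q⁻¹) * (Q⁻¹ - q ^ (-2 : ℤ) * Q) ≠ 0) :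
    char Q hq (e21 q Q) = 1 := by
  simp only [e21, L2, map_smul, map_mul, map_sub, AlgHom.commutes, char_T1, char_L1, smul_eq_mul,
    Algebra.algebraMap_self, RingHom.id_apply]
  rw [inv_mul_eq_iff_eq_mul₀ hd]
  ring

end Idempotent

/-- Under the separation conditions on `q` and `Q`, the element `e₂⁻¹` is
the unique nonzero idempotent `f` of `H₂(q²; Q, Q⁻¹)` with `(T₁+1)f = 0` and `(L₁-Q)f = 0`. -/
theorem statement10 (q Q : ℂ) (hq : q ≠ 0) (hQ : Q ≠ 0)
    (h4 : q ^ 4 ≠ 1) (h1 : Q ^ 2 ≠ 1) (h2 : Q ^ 2 ≠ q ^ 2) (h3 : q ^ 2 * Q ^ 2 ≠ 1) :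
    (e21 q Q * e21 q Q = e21 q Q ∧ e21 q Q ≠ 0 ∧
      (T1 q Q + 1) * e21 q Q = 0 ∧ (L1 q Q - algebraMap ℂ _ Q) * e21 q Q = 0) ∧
    ∀ f : Hcy (q ^ 2) Q Q⁻¹ 2,
      f * f = f → f ≠ 0 → (T1 q Q + 1) * f = 0 → (L1 q Q - algebraMap ℂ _ Q) * f = 0 →
      f = e21 q Q := by
  have hd := e21_denom_ne_zero hq hQ h4 h1 h2
  have hT := T1_add_one_mul_e21 (q := q) (Q := Q)
  have hL := L1_sub_mul_e21 (Q := Q) hq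
  have he : e21 q Q ≠ 0 := by
    intro h
    have := char_e21 hq hd
    rw [h, map_zero] at this
    exact zero_ne_one this
  refine ⟨⟨e21_mul hd (mul_eq_neg_one_smul hT) (mul_eq_smul_of_sub_mul hL), he, hT, hL⟩, ?_⟩
  intro f hff hf0 hTf hLf
  have hf : f = char Q hq f • e21 q Q := by
    rw [← mul_eq_char_smul Q hq (e21_mul_T1 hq) (e21_mul_L1 hq) f,
      e21_mul hd (mul_eq_neg_one_smul hTf) (mul_eq_smul_of_sub_mul hLf)]
  have hidem : char Q hq f * char Q hq f = char Q hq f := by rw [← map_mul, hff]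
  have hne : char Q hq f ≠ 0 := by
    intro h
    rw [h, zero_smul] at hf
    exact hf0 hf
  rw [hf, mul_left_cancel₀ hne (hidem.trans (mul_one _).symm), one_smul]

end Statement10
end
end

section
/- Let q, λ1, λ2 ∈ ℂ with q ≠ 0, 1, and let n ≥ 1. For every symmetric polynomial f ∈ ℂ[x_1, …, x_n], the element f(L_1, …, L_n) is central in the cyclotomic Hecke algebra H_n(q; λ1, λ2). -/
noncomputable section

namespace Statement11

/-- Generators of the cyclotomic Hecke algebra of type `G(2,1,n)`:
`L_1, …, L_n` and `T_1, …, T_{n-1}` (0-indexed). -/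
inductive HGen (n : ℕ) : Type
  | L : Fin n → HGen n
  | T : Fin (n - 1) → HGen n

/-- The generator `L_r` in the free algebra. -/
def LF (n : ℕ) (r : Fin n) : FreeAlgebra ℂ (HGen n) := FreeAlgebra.ι ℂ (HGen.L r)

/-- The generator `T_r` in the free algebra. -/
def TF (n : ℕ) (r : Fin (n - 1)) : FreeAlgebra ℂ (HGen n) := FreeAlgebra.ι ℂ (HGen.T r)

/-- The position `r` as an element of `Fin n`. -/
def lo {n : ℕ} (r : Fin (n - 1)) : Fin n := ⟨r.val, by have := r.2; omega⟩

/-- The position `r + 1` as an element of `Fin n`. -/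
def hi {n : ℕ} (r : Fin (n - 1)) : Fin n := ⟨r.val + 1, by have := r.2; omega⟩

/-- The defining relations of the cyclotomic Hecke algebra `H_n(q₀; λ₁, λ₂)` of type
`G(2,1,n)`. -/
inductive HRel (q0 l1 l2 : ℂ) (n : ℕ) :
    FreeAlgebra ℂ (HGen n) → FreeAlgebra ℂ (HGen n) → Prop
  | cyclo (r : Fin n) (h : r.val = 0) :
      HRel q0 l1 l2 n
        ((LF n r - algebraMap ℂ _ l1) * (LF n r - algebraMap ℂ _ l2)) 0
  | LL (r s : Fin n) : HRel q0 l1 l2 n (LF n r * LF n s) (LF n s * LF n r)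
  | quad (r : Fin (n - 1)) :
      HRel q0 l1 l2 n ((TF n r + 1) * (TF n r - algebraMap ℂ _ q0)) 0
  | TLrel (r : Fin (n - 1)) :
      HRel q0 l1 l2 n (TF n r * LF n (lo r))
        (LF n (hi r) * (TF n r - algebraMap ℂ _ q0 + 1))
  | braid (r s : Fin (n - 1)) (h : s.val = r.val + 1) :
      HRel q0 l1 l2 n (TF n r * TF n s * TF n r) (TF n s * TF n r * TF n s)
  | TLcomm (r : Fin (n - 1)) (s : Fin n) (h : r.val + 1 < s.val ∨ s.val + 1 < r.val) :
      HRel q0 l1 l2 n (TF n r * LF n s) (LF n s * TF n r)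
  | TT (r s : Fin (n - 1)) (h : r.val + 1 < s.val ∨ s.val + 1 < r.val) :
      HRel q0 l1 l2 n (TF n r * TF n s) (TF n s * TF n r)

/-- The cyclotomic Hecke algebra `H_n(q₀; λ₁, λ₂)` of type `G(2,1,n)`. -/
abbrev Hcy (q0 l1 l2 : ℂ) (n : ℕ) := RingQuot (HRel q0 l1 l2 n)

/-- The image of `L_r` in the cyclotomic Hecke algebra. -/
def Lmk (q0 l1 l2 : ℂ) (n : ℕ) (r : Fin n) : Hcy q0 l1 l2 n :=
  RingQuot.mkAlgHom ℂ (HRel q0 l1 l2 n) (LF n r)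

/-- The image of `T_r` in the cyclotomic Hecke algebra. -/
def Tmk (q0 l1 l2 : ℂ) (n : ℕ) (r : Fin (n - 1)) : Hcy q0 l1 l2 n :=
  RingQuot.mkAlgHom ℂ (HRel q0 l1 l2 n) (TF n r)

/-- Evaluation of a multivariate polynomial at the commuting Jucys–Murphy elements
`L₁, …, Lₙ` of the cyclotomic Hecke algebra. -/
def evalL (q l1 l2 : ℂ) (n : ℕ) (f : MvPolynomial (Fin n) ℂ) : Hcy q l1 l2 n :=
  ∑ s ∈ f.support,
    f.coeff s • (List.ofFn fun r : Fin n => Lmk q l1 l2 n r ^ s r).prod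

open MvPolynomial in
/-- Evaluation of polynomials at a commuting family of a noncommutative algebra. -/
theorem exists_algHom_of_commute {R A σ : Type*} [CommRing R] [Ring A] [Algebra R A]
    (L : σ → A) (hL : ∀ i j, L i * L j = L j * L i) :
    ∃ φ : MvPolynomial σ R →ₐ[R] A, ∀ i, φ (X i) = L i := by
  have : IsMulCommutative (Algebra.adjoin R (Set.range L)) :=
    Algebra.isMulCommutative_adjoin R (by
      rintro _ ⟨i, rfl⟩ _ ⟨j, rfl⟩
      exact hL i j)
  let : CommRing (Algebra.adjoin R (Set.range L)) :=
    { (Algebra.adjoin R (Set.range L)).toRing with mul_comm := this.is_comm.comm }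
  refine ⟨(Algebra.adjoin R (Set.range L)).val.comp
    (aeval (R := R) (S₁ := Algebra.adjoin R (Set.range L))
      fun i => ⟨L i, Algebra.subset_adjoin ⟨i, rfl⟩⟩), fun i => ?_⟩
  simp

open MvPolynomial in
/-- The Bernstein–Lusztig commutation rule between a Hecke generator and polynomials. -/
theorem exists_demazure_commutation {A σ : Type*} [DecidableEq σ] [Ring A] [Algebra ℂ A]
    (φ : MvPolynomial σ ℂ →ₐ[ℂ] A) (T : A) (c : ℂ) (a b : σ)
    (ha : T * φ (X a) = φ (X b) * T + φ (C c * X b))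
    (hb : T * φ (X b) = φ (X a) * T - φ (C c * X b))
    (hs : ∀ s, s ≠ a → s ≠ b → T * φ (X s) = φ (X s) * T) (g : MvPolynomial σ ℂ) :
    ∃ h : MvPolynomial σ ℂ,
      (X b - X a) * h = C c * X b * (rename (Equiv.swap a b) g - g) ∧
      T * φ g = φ (rename (Equiv.swap a b) g) * T + φ h := by
  have hX : ∀ s, ∃ h : MvPolynomial σ ℂ,
      (X b - X a) * h = C c * X b * (rename (Equiv.swap a b) (X s) - X s) ∧
      T * φ (X s) = φ (rename (Equiv.swap a b) (X s)) * T + φ h := by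
    intro s
    by_cases hsa : s = a
    · subst hsa
      refine ⟨C c * X b, ?_, by simpa using ha⟩
      simp only [rename_X, Equiv.swap_apply_left]
      ring
    by_cases hsb : s = b
    · subst hsb
      refine ⟨-(C c * X s), ?_, by simpa [sub_eq_add_neg] using hb⟩
      simp only [rename_X, Equiv.swap_apply_right]
      ring
    · refine ⟨0, ?_, ?_⟩ <;>
        simp [Equiv.swap_apply_of_ne_of_ne hsa hsb, hs s hsa hsb]
  induction g using MvPolynomial.induction_on with
  | C r =>
    refine ⟨0, by simp, ?_⟩
    have : φ (C r) = algebraMap ℂ A r := φ.commutes r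
    simp only [rename_C, this, map_zero, add_zero]
    exact (Algebra.commutes r T).symm
  | add p p' hp hp' =>
    obtain ⟨h, h1, h2⟩ := hp
    obtain ⟨h', h1', h2'⟩ := hp'
    refine ⟨h + h', ?_, ?_⟩
    · rw [mul_add, h1, h1', map_add]
      ring
    · simp only [map_add, mul_add, add_mul, h2, h2']
      abel
  | mul_X p s hp =>
    obtain ⟨h, h1, h2⟩ := hp
    obtain ⟨h', h1', h2'⟩ := hX s
    refine ⟨rename (Equiv.swap a b) p * h' + h * X s, ?_, ?_⟩
    · rw [map_mul]
      linear_combination rename (Equiv.swap a b) p * h1' + X s * h1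
    · rw [map_mul, ← mul_assoc, h2, add_mul, mul_assoc, h2']
      simp only [map_mul, map_add, mul_add, mul_assoc, add_assoc]

/-- A relation of the Hecke algebra holds in the quotient. -/
theorem mk_eq_of_rel {q l1 l2 : ℂ} {n : ℕ} {x y : FreeAlgebra ℂ (HGen n)}
    (h : HRel q l1 l2 n x y) :
    RingQuot.mkAlgHom ℂ (HRel q l1 l2 n) x = RingQuot.mkAlgHom ℂ (HRel q l1 l2 n) y :=
  RingQuot.mkAlgHom_rel ℂ h

section Relations

variable (q l1 l2 : ℂ) (n : ℕ)

theorem Lmk_mul_comm (r s : Fin n) :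
    Lmk q l1 l2 n r * Lmk q l1 l2 n s = Lmk q l1 l2 n s * Lmk q l1 l2 n r := by
  simpa only [Lmk, Tmk, map_mul] using mk_eq_of_rel (HRel.LL (q0 := q) (l1 := l1) (l2 := l2) r s)

theorem Tmk_mul_self (r : Fin (n - 1)) :
    Tmk q l1 l2 n r * (Tmk q l1 l2 n r - algebraMap ℂ _ q + 1) = algebraMap ℂ _ q := by
  have h := mk_eq_of_rel (HRel.quad (q0 := q) (l1 := l1) (l2 := l2) r)
  simp only [map_mul, map_add, map_sub, map_one, map_zero, AlgHom.commutes] at h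
  change (Tmk q l1 l2 n r + 1) * (Tmk q l1 l2 n r - algebraMap ℂ _ q) = 0 at h
  rw [← sub_eq_zero, ← h]
  noncomm_ring

theorem self_mul_Tmk (r : Fin (n - 1)) :
    (Tmk q l1 l2 n r - algebraMap ℂ _ q + 1) * Tmk q l1 l2 n r = algebraMap ℂ _ q := by
  refine Eq.trans ?_ (Tmk_mul_self q l1 l2 n r)
  have h := Algebra.commutes q (Tmk q l1 l2 n r)
  simp only [add_mul, sub_mul, mul_add, mul_sub, h, one_mul, mul_one]

theorem Tmk_mul_Lmk_lo (r : Fin (n - 1)) :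
    Tmk q l1 l2 n r * Lmk q l1 l2 n (lo r) =
      Lmk q l1 l2 n (hi r) * (Tmk q l1 l2 n r - algebraMap ℂ _ q + 1) := by
  simpa only [Lmk, Tmk, map_mul, map_add, map_sub, map_one, AlgHom.commutes] using
    mk_eq_of_rel (HRel.TLrel (q0 := q) (l1 := l1) (l2 := l2) r)

theorem Tmk_mul_Lmk_lo_mul_Tmk (r : Fin (n - 1)) :
    Tmk q l1 l2 n r * Lmk q l1 l2 n (lo r) * Tmk q l1 l2 n r =
      algebraMap ℂ _ q * Lmk q l1 l2 n (hi r) := by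
  rw [Tmk_mul_Lmk_lo, mul_assoc, self_mul_Tmk, Algebra.commutes]

variable {q}

theorem isUnit_algebraMap_Hcy (hq : q ≠ 0) : IsUnit (algebraMap ℂ (Hcy q l1 l2 n) q) :=
  (IsUnit.mk0 q hq).map _

theorem isUnit_Tmk (hq : q ≠ 0) (r : Fin (n - 1)) : IsUnit (Tmk q l1 l2 n r) := by
  have hu := isUnit_algebraMap_Hcy l1 l2 n hq
  have hc : Commute (Tmk q l1 l2 n r) (Tmk q l1 l2 n r - algebraMap ℂ _ q + 1) :=
    (Tmk_mul_self q l1 l2 n r).trans (self_mul_Tmk q l1 l2 n r).symm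
  rw [← Tmk_mul_self q l1 l2 n r] at hu
  exact (hc.isUnit_mul_iff.mp hu).1

theorem Lmk_lo_mul_Tmk (hq : q ≠ 0) (r : Fin (n - 1)) :
    Lmk q l1 l2 n (lo r) * Tmk q l1 l2 n r =
      (Tmk q l1 l2 n r - algebraMap ℂ _ q + 1) * Lmk q l1 l2 n (hi r) := by
  apply (isUnit_Tmk l1 l2 n hq r).mul_left_cancel
  rw [← mul_assoc, ← mul_assoc, Tmk_mul_Lmk_lo_mul_Tmk, Tmk_mul_self]

/-- The relation `T_{r+1} L_r = L_r T_{r+1}` is not among the defining ones, but follows from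
the braid relation and `T_r L_{r+2} = L_{r+2} T_r`. -/
theorem Tmk_succ_mul_Lmk_lo (hq : q ≠ 0) (r s : Fin (n - 1)) (hrs : s.val = r.val + 1) :
    Tmk q l1 l2 n s * Lmk q l1 l2 n (lo r) = Lmk q l1 l2 n (lo r) * Tmk q l1 l2 n s := by
  have hbraid : Tmk q l1 l2 n r * Tmk q l1 l2 n s * Tmk q l1 l2 n r =
      Tmk q l1 l2 n s * Tmk q l1 l2 n r * Tmk q l1 l2 n s := by
    simpa only [Lmk, Tmk, map_mul] using
      mk_eq_of_rel (HRel.braid (q0 := q) (l1 := l1) (l2 := l2) r s hrs)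
  have hcomm : Tmk q l1 l2 n r * Lmk q l1 l2 n (hi s) =
      Lmk q l1 l2 n (hi s) * Tmk q l1 l2 n r := by
    simpa only [Lmk, Tmk, map_mul] using
      mk_eq_of_rel (HRel.TLcomm (q0 := q) (l1 := l1) (l2 := l2) r (hi s)
        (Or.inl (by simp [hi, hrs])))
  have hlo : hi r = lo s := Fin.ext hrs.symm
  have hr := Tmk_mul_Lmk_lo_mul_Tmk q l1 l2 n r
  have hs := Tmk_mul_Lmk_lo_mul_Tmk q l1 l2 n s
  rw [hlo] at hr
  have hur := isUnit_Tmk l1 l2 n hq r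
  have hus := isUnit_Tmk l1 l2 n hq s
  generalize Tmk q l1 l2 n r = t at *
  generalize Tmk q l1 l2 n s = u at *
  generalize Lmk q l1 l2 n (lo r) = x at *
  generalize Lmk q l1 l2 n (lo s) = y at *
  generalize Lmk q l1 l2 n (hi s) = z at *
  have hk := fun w => Algebra.commutes (A := Hcy q l1 l2 n) q w
  generalize algebraMap ℂ (Hcy q l1 l2 n) q = k at *
  have hz : u * (t * x * t) * u = k * k * z := by
    rw [hr, ← mul_assoc, ← hk, mul_assoc k, mul_assoc k, hs, mul_assoc]
  have hz' : t * (u * (t * x * t) * u) = u * (t * x * t) * u * t := by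
    rw [hz, mul_assoc (k * k), ← hcomm, ← mul_assoc, ← mul_assoc (k * k), ← mul_assoc t, ← hk t,
      mul_assoc k t, ← hk t, ← mul_assoc]
  apply (hus.mul hur).mul_left_cancel
  apply (hur.mul hus).mul_right_cancel
  calc u * t * (u * x) * (t * u) = u * t * u * x * t * u := by simp only [mul_assoc]
    _ = t * (u * (t * x * t) * u) := by rw [← hbraid]; simp only [mul_assoc]
    _ = u * t * x * (t * u * t) := by rw [hz']; simp only [mul_assoc]
    _ = u * t * (x * u) * (t * u) := by rw [hbraid]; simp only [mul_assoc]

theorem Tmk_mul_Lmk_of_ne (hq : q ≠ 0) (r : Fin (n - 1)) (s : Fin n) (hlo : s ≠ lo r)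
    (hhi : s ≠ hi r) :
    Tmk q l1 l2 n r * Lmk q l1 l2 n s = Lmk q l1 l2 n s * Tmk q l1 l2 n r := by
  have h1 : s.val ≠ r.val := fun h => hlo (Fin.ext h)
  have h2 : s.val ≠ r.val + 1 := fun h => hhi (Fin.ext h)
  by_cases h3 : s.val + 1 = r.val
  · exact Tmk_succ_mul_Lmk_lo l1 l2 n hq ⟨s.val, by omega⟩ r h3.symm
  · simpa only [Lmk, Tmk, map_mul] using
      mk_eq_of_rel (HRel.TLcomm (q0 := q) (l1 := l1) (l2 := l2) r s (by omega))

end Relations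

open MvPolynomial in
theorem evalL_eq_algHom (q l1 l2 : ℂ) (n : ℕ) (φ : MvPolynomial (Fin n) ℂ →ₐ[ℂ] Hcy q l1 l2 n)
    (hφ : ∀ i, φ (X i) = Lmk q l1 l2 n i) (f : MvPolynomial (Fin n) ℂ) :
    evalL q l1 l2 n f = φ f := by
  conv_rhs => rw [f.as_sum, map_sum]
  refine Finset.sum_congr rfl fun s _ => ?_
  rw [monomial_eq, ← smul_eq_C_mul, map_smul, Finsupp.prod_fintype _ _ (by simp),
    ← List.prod_ofFn, map_list_prod, List.map_ofFn]
  congr 3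
  funext r
  simp [hφ]

open MvPolynomial in
theorem algHom_mul_Tmk_of_isSymmetric {q l1 l2 : ℂ} (hq : q ≠ 0) {n : ℕ}
    (φ : MvPolynomial (Fin n) ℂ →ₐ[ℂ] Hcy q l1 l2 n) (hφ : ∀ i, φ (X i) = Lmk q l1 l2 n i)
    (f : MvPolynomial (Fin n) ℂ) (hf : f.IsSymmetric) (r : Fin (n - 1)) :
    φ f * Tmk q l1 l2 n r = Tmk q l1 l2 n r * φ f := by
  have hC : φ (C (1 - q) * X (hi r)) =
      Lmk q l1 l2 n (hi r) - algebraMap ℂ _ q * Lmk q l1 l2 n (hi r) := by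
    have : φ (C (1 - q)) = algebraMap ℂ _ (1 - q) := φ.commutes _
    rw [map_mul, this, hφ, map_sub, map_one, sub_mul, one_mul]
  obtain ⟨h, h1, h2⟩ := exists_demazure_commutation φ (Tmk q l1 l2 n r) (1 - q) (lo r) (hi r)
    (by
      rw [hC, hφ, hφ, Tmk_mul_Lmk_lo, Algebra.commutes, mul_add, mul_sub, mul_one]
      abel)
    (by
      rw [hC, hφ, hφ, Lmk_lo_mul_Tmk l1 l2 n hq, add_mul, sub_mul, one_mul]
      abel)
    (fun s hlo hhi => by
      rw [hφ]
      exact Tmk_mul_Lmk_of_ne l1 l2 n hq r s hlo hhi) f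
  rw [hf, sub_self, mul_zero] at h1
  have hne : (X (hi r) - X (lo r) : MvPolynomial (Fin n) ℂ) ≠ 0 := by
    rw [sub_ne_zero]
    intro h
    have := congrArg Fin.val (X_injective h)
    simp [hi, lo] at this
  rw [hf, (mul_eq_zero.mp h1).resolve_left hne, map_zero, add_zero] at h2
  exact h2.symm

theorem commute_of_commute_generators {q l1 l2 : ℂ} {n : ℕ} (z : Hcy q l1 l2 n)
    (hL : ∀ r, z * Lmk q l1 l2 n r = Lmk q l1 l2 n r * z)
    (hT : ∀ r, z * Tmk q l1 l2 n r = Tmk q l1 l2 n r * z) (x : Hcy q l1 l2 n) :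
    z * x = x * z := by
  obtain ⟨y, rfl⟩ := RingQuot.mkAlgHom_surjective ℂ (HRel q l1 l2 n) x
  induction y using FreeAlgebra.induction with
  | grade0 c =>
    rw [AlgHom.commutes]
    exact (Algebra.commutes c z).symm
  | grade1 g =>
    cases g with
    | L r => exact hL r
    | T r => exact hT r
  | mul a b ha hb => rw [map_mul, ← mul_assoc, ha, mul_assoc, hb, mul_assoc]
  | add a b ha hb => rw [map_add, mul_add, add_mul, ha, hb]

/-- For every symmetric polynomial `f ∈ ℂ[x₁,…,xₙ]`, the element
`f(L₁, …, Lₙ)` is central in the cyclotomic Hecke algebra `H_n(q; λ₁, λ₂)`. -/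
theorem statement11 (q l1 l2 : ℂ) (hq0 : q ≠ 0) (hq1 : q ≠ 1) (n : ℕ) (hn : 1 ≤ n)
    (f : MvPolynomial (Fin n) ℂ) (hf : f.IsSymmetric) :
    ∀ x : Hcy q l1 l2 n, evalL q l1 l2 n f * x = x * evalL q l1 l2 n f := by
  obtain ⟨φ, hφ⟩ := exists_algHom_of_commute (R := ℂ) (Lmk q l1 l2 n) (Lmk_mul_comm q l1 l2 n)
  rw [evalL_eq_algHom q l1 l2 n φ hφ]
  refine commute_of_commute_generators _ (fun r => ?_)
    (algHom_mul_Tmk_of_isSymmetric hq0 φ hφ f hf)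
  rw [← hφ, ← map_mul, mul_comm, map_mul]

end Statement11
end
end

section
/- Let λ be a one-line bipartition of n and let s, t be standard λ-bitableaux such that t = s_k·s for a simple transposition s_k = (k, k+1) (equivalently, the sequences satisfy s(j) = t(j) for all j ≠ k and s(k) ≠ t(k)), such that s ≻ t, and such that s ≁ t (i.e., |s(j)| ≠ |t(j)| for some j). Then |t(k)| = |s(k)| + 2; in particular |s(j)| ≤ |t(j)| for all j, with strict inequality exactly at j = k. -/
namespace Statement16

/-- The sequence `t(j)` associated with a one-line standard bitableau encoded by the set `S`
of entries lying in the first component (0-indexed). -/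
def seqI (n : ℕ) (S : Finset (Fin n)) (j : ℕ) : ℤ :=
  2 * ((S.filter (fun x => x.val < j)).card : ℤ) - (j : ℤ)

/-- Consecutive values of the sequence of a bitableau differ by one. -/
theorem seqI_succ (n : ℕ) (S : Finset (Fin n)) (j : ℕ) (hj : j < n) :
    seqI n S (j + 1) = seqI n S j + 1 ∨ seqI n S (j + 1) = seqI n S j - 1 := by
  unfold seqI
  by_cases hm : (⟨j, hj⟩ : Fin n) ∈ S
  · left
    have h : S.filter (fun x => x.val < j + 1) =
        insert ⟨j, hj⟩ (S.filter (fun x => x.val < j)) := by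
      ext x
      simp only [Finset.mem_filter, Finset.mem_insert, Fin.ext_iff]
      constructor
      · rintro ⟨hx, hlt⟩
        by_cases hxj : x.val = j
        · exact Or.inl hxj
        · exact Or.inr ⟨hx, by omega⟩
      · rintro (hxj | ⟨hx, hlt⟩)
        · have hx : x = ⟨j, hj⟩ := Fin.ext hxj
          exact ⟨hx ▸ hm, by omega⟩
        · exact ⟨hx, by omega⟩
    rw [h, Finset.card_insert_of_notMem (by simp)]
    push_cast
    ring
  · right
    have h : S.filter (fun x => x.val < j + 1) = S.filter (fun x => x.val < j) := by
      refine Finset.filter_congr fun x hx => ?_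
      have hxj : x.val ≠ j := fun hxj => hm ((Fin.ext hxj : x = ⟨j, hj⟩) ▸ hx)
      omega
    rw [h]
    push_cast
    ring

/-- Let `s, t` be standard bitableaux of the same one-line shape with
`t = s_k·s` (equivalently, their sequences agree except at `k`), `s ≻ t` and `s ≁ t`.
Then `|t(k)| = |s(k)| + 2`; in particular `|s(j)| ≤ |t(j)|` for all `j`, with strict
inequality exactly at `j = k`. -/
theorem statement16 (n a b : ℕ) (hab : a + b = n) (k : ℕ) (hk1 : 1 ≤ k) (hk2 : k < n)
    (S T : Finset (Fin n)) (hS : S.card = a) (hT : T.card = a)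
    -- `t = s_k · s`: the sequences agree away from `k` and differ at `k`
    (hagree : ∀ j : ℕ, j ≤ n → j ≠ k → seqI n S j = seqI n T j)
    (hne : seqI n S k ≠ seqI n T k)
    -- `s ≻ t`
    (hsucc : ∀ j : ℕ, 1 ≤ j → j ≤ n →
      |seqI n S j| ≤ |seqI n T j| ∧ (|seqI n S j| = |seqI n T j| → seqI n S j ≤ seqI n T j))
    -- `s ≁ t`
    (hnsim : ∃ j : ℕ, 1 ≤ j ∧ j ≤ n ∧ |seqI n S j| ≠ |seqI n T j|) :
    |seqI n T k| = |seqI n S k| + 2 ∧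
    (∀ j : ℕ, 1 ≤ j → j ≤ n →
      |seqI n S j| ≤ |seqI n T j| ∧ (|seqI n S j| < |seqI n T j| ↔ j = k)) := by
  have hdiff : |seqI n S k| ≠ |seqI n T k| := by
    obtain ⟨j, -, hjn, hj⟩ := hnsim
    by_cases hjk : j = k
    · exact hjk ▸ hj
    · exact absurd (congrArg abs (hagree j hjn hjk)) hj
  have hle := (hsucc k hk1 hk2.le).1
  have habs : |seqI n T k| = |seqI n S k| + 2 := by
    obtain ⟨m, rfl⟩ : ∃ m, k = m + 1 := ⟨k - 1, by omega⟩
    have hm := hagree m (by omega) (by omega)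
    have h1 := seqI_succ n S m (by omega)
    have h2 := seqI_succ n T m (by omega)
    rcases abs_cases (seqI n S (m + 1)) with hs | hs <;>
      rcases abs_cases (seqI n T (m + 1)) with ht | ht <;> omega
  refine ⟨habs, fun j hj1 hjn => ⟨(hsucc j hj1 hjn).1, ?_⟩⟩
  constructor
  · intro hlt
    by_contra hjk
    exact hlt.ne (congrArg abs (hagree j hjn hjk))
  · rintro rfl
    exact lt_of_le_of_ne hle hdiff

end Statement16
end

section
/- Let λ = ((a),(b)) be a one-line bipartition of n and let t be a standard λ-bitableau. Then there exist k ≥ 0, simple transpositions s_{i_1}, …, s_{i_k} ∈ S_n, and standard λ-bitableaux t^λ = t_0, t_1, …, t_k = t such that t_j = s_{i_j}·t_{j−1} and t_{j−1} ≻ t_j for every j = 1, …, k. -/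
namespace Statement17

/-- The sequence `t(j)` associated with a one-line standard bitableau encoded by the set `S`
of entries lying in the first component (0-indexed). -/
def seqI (n : ℕ) (S : Finset (Fin n)) (j : ℕ) : ℤ :=
  2 * ((S.filter (fun x => x.val < j)).card : ℤ) - (j : ℤ)

/-- The order `s ⪰ t` on standard bitableaux of the same one-line shape. -/
def tabSucceq (n : ℕ) (S T : Finset (Fin n)) : Prop :=
  ∀ j : ℕ, 1 ≤ j → j ≤ n →
    |seqI n S j| ≤ |seqI n T j| ∧ (|seqI n S j| = |seqI n T j| → seqI n S j ≤ seqI n T j)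

/-- The first-component entry set of the maximal bitableau `t^λ` for `λ = ((a),(b))` with
`a + b = n` (0-indexed): with `m₀ = min a b`, the numbers `2, 4, …, 2m₀` (i.e. the odd
indices `< 2m₀`) lie in the first component, and the numbers `> 2m₀` lie in the first
component exactly when `b ≤ a`. -/
def Slam (n a b : ℕ) : Finset (Fin n) :=
  Finset.univ.filter fun j : Fin n =>
    (j.val % 2 = 1 ∧ j.val < 2 * min a b) ∨ (b ≤ a ∧ 2 * min a b ≤ j.val)

/-- `x` is an index below `n` lying in `S`. -/
def HasIndex (n : ℕ) (S : Finset (Fin n)) (x : ℕ) : Prop :=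
  ∃ h : x < n, (⟨x, h⟩ : Fin n) ∈ S

open Classical in
/-- The increment of the sequence of `S` at index `x`. -/
noncomputable def increment (n : ℕ) (S : Finset (Fin n)) (x : ℕ) : ℤ :=
  if HasIndex n S x then 1 else -1

lemma increment_congr {n x y : ℕ} {S T : Finset (Fin n)}
    (h : HasIndex n S x ↔ HasIndex n T y) : increment n S x = increment n T y := by
  by_cases hx : HasIndex n S x
  · rw [increment, increment, if_pos hx, if_pos (h.1 hx)]
  · rw [increment, increment, if_neg hx, if_neg fun hy => hx (h.2 hy)]

lemma seqI_zero (n : ℕ) (S : Finset (Fin n)) : seqI n S 0 = 0 := by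
  simp [seqI]

lemma seqI_succ (n : ℕ) (S : Finset (Fin n)) (j : ℕ) :
    seqI n S (j + 1) = seqI n S j + increment n S j := by
  unfold seqI increment
  split_ifs with h
  · obtain ⟨hj, hm⟩ := h
    have key : S.filter (fun x => x.val < j + 1) =
        insert ⟨j, hj⟩ (S.filter (fun x => x.val < j)) := by
      ext x
      simp only [Finset.mem_filter, Finset.mem_insert, Fin.ext_iff]
      constructor
      · rintro ⟨h1, h2⟩
        by_cases hx : x.val = j
        · exact Or.inl hx
        · exact Or.inr ⟨h1, by omega⟩
      · rintro (h1 | ⟨h1, h2⟩)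
        · obtain rfl : x = ⟨j, hj⟩ := Fin.ext h1
          exact ⟨hm, by simp⟩
        · exact ⟨h1, by omega⟩
    rw [key, Finset.card_insert_of_notMem (by simp)]
    push_cast
    ring
  · have key : S.filter (fun x => x.val < j + 1) = S.filter (fun x => x.val < j) := by
      refine Finset.filter_congr fun x hx => ?_
      have hne : x.val ≠ j := fun hxj => h ⟨hxj ▸ x.isLt, by subst hxj; exact hx⟩
      omega
    rw [key]
    push_cast
    ring

lemma seqI_self (n : ℕ) (S : Finset (Fin n)) : seqI n S n = 2 * (S.card : ℤ) - n := by
  unfold seqI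
  rw [Finset.filter_true_of_mem fun x _ => x.isLt]

/-- The image of `S` under the simple transposition exchanging `i` and `i + 1`. -/
def adjSwap (n : ℕ) (i : ℕ) (hi : i + 1 < n) (S : Finset (Fin n)) : Finset (Fin n) :=
  S.image (Equiv.swap ⟨i, by omega⟩ ⟨i + 1, hi⟩)

lemma mem_adjSwap {n i : ℕ} {hi : i + 1 < n} {S : Finset (Fin n)} {x : Fin n} :
    x ∈ adjSwap n i hi S ↔ Equiv.swap (⟨i, by omega⟩ : Fin n) ⟨i + 1, hi⟩ x ∈ S := by
  unfold adjSwap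
  rw [Finset.mem_image]
  constructor
  · rintro ⟨y, hy, rfl⟩
    simpa using hy
  · exact fun h => ⟨_, h, by simp⟩

lemma adjSwap_adjSwap {n i : ℕ} {hi : i + 1 < n} {S : Finset (Fin n)} :
    adjSwap n i hi (adjSwap n i hi S) = S := by
  ext x
  simp [mem_adjSwap]

lemma card_adjSwap {n i : ℕ} {hi : i + 1 < n} {S : Finset (Fin n)} :
    (adjSwap n i hi S).card = S.card :=
  Finset.card_image_of_injective _ (Equiv.injective _)

lemma hasIndex_adjSwap_left {n i : ℕ} {hi : i + 1 < n} {S : Finset (Fin n)} :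
    HasIndex n (adjSwap n i hi S) i ↔ HasIndex n S (i + 1) := by
  simp [HasIndex, mem_adjSwap, hi, show i < n by omega]

lemma hasIndex_adjSwap_right {n i : ℕ} {hi : i + 1 < n} {S : Finset (Fin n)} :
    HasIndex n (adjSwap n i hi S) (i + 1) ↔ HasIndex n S i := by
  simp [HasIndex, mem_adjSwap, hi, show i < n by omega]

lemma hasIndex_adjSwap_of_ne {n i x : ℕ} {hi : i + 1 < n} {S : Finset (Fin n)}
    (h : x ≠ i) (h' : x ≠ i + 1) :
    HasIndex n (adjSwap n i hi S) x ↔ HasIndex n S x := by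
  refine exists_congr fun hx => ?_
  rw [mem_adjSwap, Equiv.swap_apply_of_ne_of_ne] <;> simpa [Fin.ext_iff]

lemma seqI_adjSwap (n i : ℕ) (hi : i + 1 < n) (S : Finset (Fin n)) (j : ℕ) :
    seqI n (adjSwap n i hi S) j =
      seqI n S j + if j = i + 1 then increment n S (i + 1) - increment n S i else 0 := by
  induction j with
  | zero => simp [seqI_zero]
  | succ j ih =>
    rw [seqI_succ, seqI_succ, ih]
    by_cases h : j = i
    · subst h
      have : increment n (adjSwap n j hi S) j = increment n S (j + 1) :=
        increment_congr hasIndex_adjSwap_left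
      simp [this]
    by_cases h' : j = i + 1
    · subst h'
      have : increment n (adjSwap n i hi S) (i + 1) = increment n S i :=
        increment_congr hasIndex_adjSwap_right
      simp [this]
      ring
    · have : increment n (adjSwap n i hi S) j = increment n S j :=
        increment_congr (hasIndex_adjSwap_of_ne h h')
      simp [this, h, h']

/-- A natural number measuring how far `S` is from the maximal bitableau. -/
def height (n : ℕ) (S : Finset (Fin n)) : ℕ :=
  ∑ j ∈ Finset.range n, (4 * seqI n S j + 1).natAbs

/-- The simple transposition at `i` makes `S` strictly larger for the order `≻`: the sequence
has a positive peak or a valley below `-1` at `i + 1`. -/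
def Improvable (n : ℕ) (S : Finset (Fin n)) (i : ℕ) : Prop :=
  (HasIndex n S i ∧ ¬ HasIndex n S (i + 1) ∧ 1 ≤ seqI n S (i + 1)) ∨
    (¬ HasIndex n S i ∧ HasIndex n S (i + 1) ∧ seqI n S (i + 1) ≤ -2)

lemma Improvable.seqI_adjSwap {n i : ℕ} (hi : i + 1 < n) {S : Finset (Fin n)}
    (h : Improvable n S i) :
    (1 ≤ seqI n S (i + 1) ∧ seqI n (adjSwap n i hi S) (i + 1) = seqI n S (i + 1) - 2) ∨
      (seqI n S (i + 1) ≤ -2 ∧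
        seqI n (adjSwap n i hi S) (i + 1) = seqI n S (i + 1) + 2) := by
  rw [Statement17.seqI_adjSwap]
  rcases h with ⟨h1, h2, h3⟩ | ⟨h1, h2, h3⟩
  · exact Or.inl ⟨h3, by simp [increment, h1, h2]; ring⟩
  · exact Or.inr ⟨h3, by simp [increment, h1, h2]⟩

lemma Improvable.tabSucceq {n i : ℕ} (hi : i + 1 < n) {S : Finset (Fin n)}
    (h : Improvable n S i) : tabSucceq n (adjSwap n i hi S) S := by
  intro j _ _
  by_cases hj : j = i + 1
  · subst hj
    rcases h.seqI_adjSwap hi with ⟨h1, h2⟩ | ⟨h1, h2⟩ <;> rw [h2] <;> grind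
  · simp [Statement17.seqI_adjSwap, hj]

lemma Improvable.height_lt {n i : ℕ} (hi : i + 1 < n) {S : Finset (Fin n)}
    (h : Improvable n S i) : height n (adjSwap n i hi S) < height n S := by
  have hlt : (4 * seqI n (adjSwap n i hi S) (i + 1) + 1).natAbs <
      (4 * seqI n S (i + 1) + 1).natAbs := by
    rcases h.seqI_adjSwap hi with ⟨h1, h2⟩ | ⟨h1, h2⟩ <;> omega
  refine Finset.sum_lt_sum (fun j _ => ?_) ⟨i + 1, Finset.mem_range.2 hi, hlt⟩
  by_cases hj : j = i + 1
  · exact hj ▸ hlt.le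
  · simp [Statement17.seqI_adjSwap, hj]

lemma exists_pattern_of_not_improvable {n : ℕ} {S : Finset (Fin n)}
    (h : ∀ i, i + 1 < n → ¬ Improvable n S i) (j : ℕ) (hj : j ≤ n) :
    ∃ k ≤ j, (∀ x < k, (HasIndex n S x ↔ x % 2 = 1)) ∧
      ((k % 2 = 0 ∧ (∀ x, k ≤ x → x < j → HasIndex n S x) ∧ seqI n S j = j - k) ∨
        (k % 2 = 1 ∧ (∀ x, k ≤ x → x < j → ¬ HasIndex n S x) ∧
          seqI n S j = -1 - (j - k))) := by
  induction j with
  | zero => exact ⟨0, le_rfl, by simp, Or.inl (by simp [seqI_zero])⟩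
  | succ j ih =>
    obtain ⟨k, hk, hpat, hcase⟩ := ih (by omega)
    have hs := seqI_succ n S j
    unfold increment at hs
    have hext : (HasIndex n S j ↔ j % 2 = 1) → k = j →
        ∀ x < j + 1, (HasIndex n S x ↔ x % 2 = 1) := by
      rintro hjj rfl x hx
      rcases Nat.lt_succ_iff_lt_or_eq.1 hx with hx | rfl
      · exact hpat x hx
      · exact hjj
    have hprev : k < j → (HasIndex n S (j - 1) ↔ k % 2 = 0) := by
      intro hkj
      rcases hcase with ⟨h0, h1, -⟩ | ⟨h0, h1, -⟩
      · simpa [h0] using h1 (j - 1) (by omega) (by omega)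
      · simpa [h0] using h1 (j - 1) (by omega) (by omega)
    have hnext : k < j → (HasIndex n S j ↔ k % 2 = 0) := by
      intro hkj
      have hni := h (j - 1) (by omega)
      unfold Improvable at hni
      rw [Nat.sub_add_cancel (by omega), hprev hkj] at hni
      rcases hcase with ⟨h0, -, h1⟩ | ⟨h0, -, h1⟩
      · have : 1 ≤ seqI n S j := by omega
        tauto
      · have : seqI n S j ≤ -2 := by omega
        have : ¬ k % 2 = 0 := by omega
        tauto
    have hlast : ∀ {p : ℕ → Prop}, (∀ x, k ≤ x → x < j → p x) → p j →
        ∀ x, k ≤ x → x < j + 1 → p x := by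
      intro p hp hpj x hkx hx
      rcases Nat.lt_succ_iff_lt_or_eq.1 hx with hx | rfl
      · exact hp x hkx hx
      · exact hpj
    by_cases hm : HasIndex n S j
    · rw [if_pos hm] at hs
      rcases hcase with ⟨h0, h1, h2⟩ | ⟨h0, h1, h2⟩
      · exact ⟨k, by omega, hpat, Or.inl ⟨h0, hlast h1 hm, by push_cast; omega⟩⟩
      · have hkj : k = j := by
          by_contra hne
          have := (hnext (by omega)).1 hm
          omega
        refine ⟨j + 1, le_rfl, hext (by simp [hm]; omega) hkj, Or.inl ⟨by omega, ?_, ?_⟩⟩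
        · intro x hx hx'
          omega
        · push_cast
          omega
    · rw [if_neg hm] at hs
      rcases hcase with ⟨h0, h1, h2⟩ | ⟨h0, h1, h2⟩
      · have hkj : k = j := by
          by_contra hne
          exact hm ((hnext (by omega)).2 h0)
        refine ⟨j + 1, le_rfl, hext (by simp [hm]; omega) hkj, Or.inr ⟨by omega, ?_, ?_⟩⟩
        · intro x hx hx'
          omega
        · push_cast
          omega
      · exact ⟨k, by omega, hpat, Or.inr ⟨h0, hlast h1 hm, by push_cast; omega⟩⟩

lemma eq_Slam_of_not_improvable {n a b : ℕ} (hab : a + b = n) {S : Finset (Fin n)}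
    (hS : S.card = a) (h : ∀ i, i + 1 < n → ¬ Improvable n S i) : S = Slam n a b := by
  obtain ⟨k, hk, hpat, hcase⟩ := exists_pattern_of_not_improvable h n le_rfl
  rw [seqI_self, hS] at hcase
  ext ⟨x, hx⟩
  have hmem : (⟨x, hx⟩ : Fin n) ∈ S ↔ HasIndex n S x := by simp [HasIndex, hx]
  rw [hmem]
  simp only [Slam, Finset.mem_filter, Finset.mem_univ, true_and]
  rcases lt_or_ge x k with hxk | hxk
  · rw [hpat x hxk]
    omega
  · rcases hcase with ⟨h0, h1, h2⟩ | ⟨h0, h1, h2⟩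
    · simp only [h1 x hxk hx, true_iff]
      omega
    · simp only [h1 x hxk hx, false_iff]
      omega

/-- Every standard bitableau `t` of one-line shape `λ = ((a),(b))` can be
reached from `t^λ` by a chain of simple transpositions which is strictly decreasing for the
order `≻` (the symmetric group acting by permuting entries, i.e. by taking images of the
first-component entry sets). -/
theorem statement17 (n a b : ℕ) (hab : a + b = n) (S : Finset (Fin n)) (hS : S.card = a) :
    ∃ (K : ℕ) (c : ℕ → Finset (Fin n)),
      c 0 = Slam n a b ∧ c K = S ∧
      ∀ j < K,
        (∃ (i : ℕ) (hi : i + 1 < n),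
          c (j + 1) = (c j).image (Equiv.swap ⟨i, by omega⟩ ⟨i + 1, hi⟩)) ∧
        tabSucceq n (c j) (c (j + 1)) ∧ c j ≠ c (j + 1) := by
  induction hN : height n S using Nat.strong_induction_on generalizing S with
  | _ N ih =>
    by_cases hex : ∃ i, i + 1 < n ∧ Improvable n S i
    · obtain ⟨i, hi, himp⟩ := hex
      have hlt := himp.height_lt hi
      obtain ⟨K, c, hc0, hcK, hstep⟩ :=
        ih _ (hN ▸ hlt) (adjSwap n i hi S) (card_adjSwap.trans hS) rfl
      refine ⟨K + 1, fun j => if j ≤ K then c j else S, by simpa using hc0, by simp, ?_⟩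
      intro j hj
      rcases Nat.lt_succ_iff_lt_or_eq.1 hj with hj | rfl
      · simpa only [if_pos hj.le, if_pos (Nat.succ_le_of_lt hj)] using hstep j hj
      · simp only [le_refl, if_true, if_neg (Nat.not_succ_le_self j), hcK]
        refine ⟨⟨i, hi, adjSwap_adjSwap.symm⟩, himp.tabSucceq hi, fun heq => ?_⟩
        rw [heq] at hlt
        exact lt_irrefl _ hlt
    · push Not at hex
      exact ⟨0, fun _ => S, eq_Slam_of_not_improvable hab hS hex, rfl, by simp⟩

end Statement17
end

section
/- Let λ = ((a),(b)) be a one-line bipartition of n, let t be a standard λ-bitableau, and suppose t^λ = t_0, t_1, …, t_k = t are standard λ-bitableaux with t_j = s_{i_j}·t_{j−1} and t_{j−1} ≻ t_j for each j = 1, …, k, where the s_{i_j} are simple transpositions of S_n. Then the word s_{i_k} s_{i_{k−1}} ⋯ s_{i_1} is a reduced expression; that is, the Coxeter length of the permutation w = s_{i_k} s_{i_{k−1}} ⋯ s_{i_1} ∈ S_n equals k (and w·t^λ = t). -/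
namespace Statement18

/-- The sequence `t(j)` associated with a one-line standard bitableau encoded by the set `S`
of entries lying in the first component (0-indexed). -/
def seqI (n : ℕ) (S : Finset (Fin n)) (j : ℕ) : ℤ :=
  2 * ((S.filter (fun x => x.val < j)).card : ℤ) - (j : ℤ)

/-- The order `s ⪰ t` on standard bitableaux of the same one-line shape. -/
def tabSucceq (n : ℕ) (S T : Finset (Fin n)) : Prop :=
  ∀ j : ℕ, 1 ≤ j → j ≤ n →
    |seqI n S j| ≤ |seqI n T j| ∧ (|seqI n S j| = |seqI n T j| → seqI n S j ≤ seqI n T j)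

/-- The first-component entry set of the maximal bitableau `t^λ` for `λ = ((a),(b))` with
`a + b = n` (0-indexed). -/
def Slam (n a b : ℕ) : Finset (Fin n) :=
  Finset.univ.filter fun j : Fin n =>
    (j.val % 2 = 1 ∧ j.val < 2 * min a b) ∨ (b ≤ a ∧ 2 * min a b ≤ j.val)

/-- The transposition of `i` and `i + 1`. -/
def adjSwap {n i : ℕ} (hi : i + 1 < n) : Equiv.Perm (Fin n) :=
  Equiv.swap ⟨i, by omega⟩ ⟨i + 1, hi⟩

/-- The pairs `x < y` whose order is reversed by `w`. -/
def inversions {n : ℕ} (w : Equiv.Perm (Fin n)) : Finset (Fin n × Fin n) :=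
  Finset.univ.filter fun p => p.1 < p.2 ∧ w p.2 < w p.1

lemma mem_inversions {n : ℕ} {w : Equiv.Perm (Fin n)} {p : Fin n × Fin n} :
    p ∈ inversions w ↔ p.1 < p.2 ∧ w p.2 < w p.1 := by
  rw [inversions, Finset.mem_filter_univ]

/-- The number of elements of `A` smaller than `j`. -/
def countBelow {n : ℕ} (A : Finset (Fin n)) (j : ℕ) : ℕ :=
  (A.filter fun x => x.val < j).card

lemma adjSwap_apply_val {n i : ℕ} (hi : i + 1 < n) (x : Fin n) :
    (adjSwap hi x).val = if x.val = i then i + 1 else if x.val = i + 1 then i else x.val := by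
  unfold adjSwap
  rw [Equiv.swap_apply_def]
  simp only [Fin.ext_iff]
  split_ifs <;> rfl

lemma adjSwap_lt_adjSwap {n i : ℕ} (hi : i + 1 < n) {p q : Fin n} (h : p < q)
    (hpq : ¬ (p.val = i ∧ q.val = i + 1)) : adjSwap hi p < adjSwap hi q := by
  rw [Fin.lt_def] at h ⊢
  rw [adjSwap_apply_val, adjSwap_apply_val]
  split_ifs <;> omega

lemma lt_of_adjSwap_lt_adjSwap {n i : ℕ} (hi : i + 1 < n) {p q : Fin n}
    (h : adjSwap hi p < adjSwap hi q) (hpq : ¬ (q.val = i ∧ p.val = i + 1)) : p < q := by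
  rw [Fin.lt_def] at h ⊢
  rw [adjSwap_apply_val, adjSwap_apply_val] at h
  split_ifs at h <;> omega

lemma inversions_one {n : ℕ} : inversions (1 : Equiv.Perm (Fin n)) = ∅ := by
  ext p
  rw [mem_inversions]
  simpa using le_of_lt

lemma card_inversions_adjSwap_mul_le {n i : ℕ} (hi : i + 1 < n) (w : Equiv.Perm (Fin n)) :
    (inversions (adjSwap hi * w)).card ≤ (inversions w).card + 1 := by
  refine (Finset.card_le_card (t := insert (w.symm ⟨i, by omega⟩, w.symm ⟨i + 1, hi⟩)
    (inversions w)) ?_).trans (Finset.card_insert_le _ _)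
  rintro ⟨x, y⟩ hp
  simp only [mem_inversions, Equiv.Perm.coe_mul,
    Function.comp_apply, Finset.mem_insert, Prod.mk.injEq, Equiv.eq_symm_apply, Fin.ext_iff]
    at hp ⊢
  by_cases h : (w x).val = i ∧ (w y).val = i + 1
  · exact Or.inl h
  · exact Or.inr ⟨hp.1, lt_of_adjSwap_lt_adjSwap hi hp.2 h⟩

lemma card_inversions_adjSwap_mul {n i : ℕ} (hi : i + 1 < n) (w : Equiv.Perm (Fin n))
    {x y : Fin n} (hx : (w x).val = i) (hy : (w y).val = i + 1) (hxy : x < y) :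
    (inversions (adjSwap hi * w)).card = (inversions w).card + 1 := by
  have key : inversions (adjSwap hi * w) = insert (x, y) (inversions w) := by
    ext ⟨p, q⟩
    have hp : p = x ↔ (w p).val = i := by
      rw [← hx, Fin.val_inj, w.injective.eq_iff]
    have hq : q = y ↔ (w q).val = i + 1 := by
      rw [← hy, Fin.val_inj, w.injective.eq_iff]
    have hp' : p = y ↔ (w p).val = i + 1 := by
      rw [← hy, Fin.val_inj, w.injective.eq_iff]
    have hq' : q = x ↔ (w q).val = i := by
      rw [← hx, Fin.val_inj, w.injective.eq_iff]
    simp only [mem_inversions, Equiv.Perm.coe_mul,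
      Function.comp_apply, Finset.mem_insert, Prod.mk.injEq]
    constructor
    · rintro ⟨h1, h2⟩
      by_cases h : (w p).val = i ∧ (w q).val = i + 1
      · exact Or.inl ⟨hp.2 h.1, hq.2 h.2⟩
      · exact Or.inr ⟨h1, lt_of_adjSwap_lt_adjSwap hi h2 h⟩
    · rintro (⟨rfl, rfl⟩ | ⟨h1, h2⟩)
      · refine ⟨hxy, ?_⟩
        rw [Fin.lt_def, adjSwap_apply_val, adjSwap_apply_val, hx, hy]
        simp
      · refine ⟨h1, adjSwap_lt_adjSwap hi h2 ?_⟩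
        rintro ⟨h3, h4⟩
        rw [hq'.2 h3, hp'.2 h4] at h1
        exact absurd h1 hxy.asymm
  rw [key, Finset.card_insert_of_notMem]
  simp only [mem_inversions, Fin.lt_def, hx, hy]
  omega

/-- The inversion number is a lower bound for the length of any word in adjacent
transpositions. -/
lemma card_inversions_prod_le {n : ℕ} (L : List (Equiv.Perm (Fin n)))
    (hL : ∀ τ ∈ L, ∃ (i : ℕ) (hi : i + 1 < n), τ = adjSwap hi) :
    (inversions L.prod).card ≤ L.length := by
  induction L with
  | nil => simp [inversions_one]
  | cons τ L ih =>
    obtain ⟨i, hi, rfl⟩ := hL τ List.mem_cons_self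
    rw [List.prod_cons, List.length_cons]
    exact (card_inversions_adjSwap_mul_le hi _).trans
      (Nat.succ_le_succ (ih fun σ hσ => hL σ (List.mem_cons_of_mem _ hσ)))

lemma seqI_eq {n : ℕ} (A : Finset (Fin n)) (j : ℕ) :
    seqI n A j = 2 * (countBelow A j : ℤ) - j := rfl

lemma countBelow_succ {n : ℕ} (A : Finset (Fin n)) (j : Fin n) :
    countBelow A (j.val + 1) = countBelow A j.val + if j ∈ A then 1 else 0 := by
  unfold countBelow
  split_ifs with h
  · rw [← Finset.card_insert_of_notMem (a := j) (by simp)]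
    congr 1
    ext x
    simp only [Finset.mem_filter, Finset.mem_insert, Fin.ext_iff]
    constructor
    · rintro ⟨h1, h2⟩
      by_cases hx : x.val = j.val
      · exact Or.inl hx
      · exact Or.inr ⟨h1, by omega⟩
    · rintro (h1 | h1)
      · exact ⟨Fin.ext h1 ▸ h, by omega⟩
      · exact ⟨h1.1, by omega⟩
  · rw [Nat.add_zero]
    congr 1
    refine Finset.filter_congr fun x hx => ?_
    have : x.val ≠ j.val := fun h' => h (Fin.ext h' ▸ hx)
    omega

lemma countBelow_add_countBelow_compl {n : ℕ} (A : Finset (Fin n)) {j : ℕ} (hj : j ≤ n) :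
    countBelow A j + countBelow Aᶜ j = j := by
  induction j with
  | zero => simp [countBelow]
  | succ j ih =>
    have h1 := countBelow_succ A ⟨j, hj⟩
    have h2 := countBelow_succ Aᶜ ⟨j, hj⟩
    have h3 := ih (by omega)
    simp only [Finset.mem_compl] at h1 h2
    split_ifs at h1 h2 <;> omega

lemma countBelow_image {n : ℕ} {A : Finset (Fin n)} {w : Equiv.Perm (Fin n)}
    (hw : StrictMonoOn w A) {u : Fin n} (hu : u ∈ A) :
    countBelow (A.image w) (w u).val = countBelow A u.val := by
  unfold countBelow
  rw [Finset.filter_image, Finset.card_image_of_injective _ w.injective]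
  congr 1
  exact Finset.filter_congr fun x hx => hw.lt_iff_lt hx hu

lemma mem_image_perm {n : ℕ} {A : Finset (Fin n)} {w : Equiv.Perm (Fin n)} {x : Fin n} :
    x ∈ A.image w ↔ w.symm x ∈ A := by
  rw [← Finset.mem_map_equiv, Finset.map_eq_image]
  rfl

lemma image_compl_perm {n : ℕ} (A : Finset (Fin n)) (w : Equiv.Perm (Fin n)) :
    Aᶜ.image w = (A.image w)ᶜ := by
  ext x
  simp only [mem_image_perm, Finset.mem_compl]

lemma countBelow_Slam {n a b : ℕ} (hab : a + b = n) {j : ℕ} (hj : j ≤ n) :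
    countBelow (Slam n a b) j =
      if j ≤ 2 * min a b then j / 2 else if b ≤ a then j - min a b else min a b := by
  induction j with
  | zero => simp [countBelow]
  | succ j ih =>
    have h := countBelow_succ (Slam n a b) ⟨j, hj⟩
    have h' := ih (by omega)
    simp only [Slam, Finset.mem_filter, Finset.mem_univ, true_and] at h h' ⊢
    rw [h, h']
    split_ifs <;> omega

/-- In `t^λ`, the order of an entry `u` of the first component and an entry `d` of the second
is determined by their ranks within the components. -/
lemma lt_iff_countBelow_Slam {n a b : ℕ} (hab : a + b = n) {u d : Fin n}
    (hu : u ∈ Slam n a b) (hd : d ∉ Slam n a b) :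
    d < u ↔ countBelow (Slam n a b)ᶜ d.val ≤ countBelow (Slam n a b) u.val := by
  have h1 := countBelow_Slam hab u.2.le
  have h2 := countBelow_Slam hab d.2.le
  have h3 := countBelow_add_countBelow_compl (Slam n a b) d.2.le
  have hu2 := u.2
  have hd2 := d.2
  simp only [Slam, Finset.mem_filter, Finset.mem_univ, true_and] at hu hd
  rw [Fin.lt_def]
  split_ifs at h1 h2 <;> omega

lemma countBelow_image_adjSwap {n i : ℕ} (hi : i + 1 < n) (A : Finset (Fin n)) :
    countBelow (A.image (adjSwap hi)) i = countBelow A i := by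
  unfold countBelow
  rw [Finset.filter_image, Finset.card_image_of_injective _ (adjSwap hi).injective]
  congr 1
  refine Finset.filter_congr fun x _ => ?_
  rw [adjSwap_apply_val]
  split_ifs <;> omega

lemma mem_image_adjSwap {n i : ℕ} (hi : i + 1 < n) (A : Finset (Fin n)) :
    (⟨i, by omega⟩ : Fin n) ∈ A.image (adjSwap hi) ↔ (⟨i + 1, hi⟩ : Fin n) ∈ A := by
  rw [mem_image_perm, adjSwap, Equiv.symm_swap, Equiv.swap_apply_left]

lemma image_adjSwap_eq_self {n i : ℕ} (hi : i + 1 < n) {A : Finset (Fin n)}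
    (h : (⟨i, by omega⟩ : Fin n) ∈ A ↔ (⟨i + 1, hi⟩ : Fin n) ∈ A) :
    A.image (adjSwap hi) = A := by
  ext x
  rw [mem_image_perm, adjSwap, Equiv.symm_swap, Equiv.swap_apply_def]
  split_ifs with h1 h2
  · rw [h1, h]
  · rw [h2, h]
  · rfl

/-- Composing with `s_i` preserves monotonicity on a set whose image does not contain
both `i` and `i + 1`. -/
lemma StrictMonoOn.adjSwap_mul {n i : ℕ} (hi : i + 1 < n) {A : Finset (Fin n)}
    {w : Equiv.Perm (Fin n)} (hw : StrictMonoOn w A)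
    (h : ¬ ((⟨i, by omega⟩ : Fin n) ∈ A.image w ∧ (⟨i + 1, hi⟩ : Fin n) ∈ A.image w)) :
    StrictMonoOn (adjSwap hi * w : Equiv.Perm (Fin n)) A := by
  intro x hx y hy hxy
  refine adjSwap_lt_adjSwap hi (hw hx hy hxy) fun ⟨h1, h2⟩ => h ⟨?_, ?_⟩
  · exact Finset.mem_image.2 ⟨x, hx, Fin.ext h1⟩
  · exact Finset.mem_image.2 ⟨y, hy, Fin.ext h2⟩

/-- A descending step in the order on bitableaux creates an inversion. -/
lemma symm_lt_symm_of_tabSucceq {n a b i : ℕ} (hab : a + b = n) (hi : i + 1 < n)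
    {w : Equiv.Perm (Fin n)} (hA : StrictMonoOn w (Slam n a b))
    (hB : StrictMonoOn w ((Slam n a b)ᶜ : Finset (Fin n)))
    (hsucc : tabSucceq n ((Slam n a b).image w) (((Slam n a b).image w).image (adjSwap hi)))
    (hne : ¬ ((⟨i, by omega⟩ : Fin n) ∈ (Slam n a b).image w ↔
      (⟨i + 1, hi⟩ : Fin n) ∈ (Slam n a b).image w)) :
    w.symm ⟨i, by omega⟩ < w.symm ⟨i + 1, hi⟩ := by
  set A := Slam n a b with hAdef
  set C := A.image w with hC
  set x := w.symm ⟨i, by omega⟩ with hx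
  set y := w.symm ⟨i + 1, hi⟩ with hy
  have hwx : w x = ⟨i, by omega⟩ := by simp [hx]
  have hwy : w y = ⟨i + 1, hi⟩ := by simp [hy]
  have memx : (⟨i, by omega⟩ : Fin n) ∈ C ↔ x ∈ A := mem_image_perm
  have memy : (⟨i + 1, hi⟩ : Fin n) ∈ C ↔ y ∈ A := mem_image_perm
  have hs := hsucc (i + 1) (by omega) (by omega)
  have c1 := countBelow_succ C ⟨i, by omega⟩
  have c2 := countBelow_succ (C.image (adjSwap hi)) ⟨i, by omega⟩
  have c3 := countBelow_succ Cᶜ ⟨i, by omega⟩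
  have c4 := countBelow_add_countBelow_compl C (j := i) (by omega)
  simp only [mem_image_adjSwap, countBelow_image_adjSwap, Finset.mem_compl] at c1 c2 c3
  rw [seqI_eq, seqI_eq] at hs
  have e (u : Fin n) (hu : u ∈ A) := countBelow_image hA hu
  have e' (u : Fin n) (hu : u ∉ A) := countBelow_image hB (Finset.mem_compl.2 hu)
  rw [image_compl_perm] at e'
  by_cases hxA : x ∈ A
  · have hyA : y ∉ A := by tauto
    have r1 := e x hxA
    have r2 := e' y hyA
    rw [hwx] at r1
    rw [hwy] at r2
    have k := lt_iff_countBelow_Slam hab hxA hyA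
    have hxy : x ≠ y := fun h => hyA (h ▸ hxA)
    rw [← not_le, le_iff_lt_or_eq, k]
    simp only [memx, memy, hxA, hyA, if_true, if_false, not_true] at c1 c2 c3
    simp only [← hAdef, ← hC] at *
    grind
  · have hyA : y ∈ A := by tauto
    have r1 := e y hyA
    have r2 := e' x hxA
    rw [hwy] at r1
    rw [hwx] at r2
    rw [lt_iff_countBelow_Slam hab hyA hxA]
    simp only [memx, memy, hxA, hyA, if_true, if_false, not_false_eq_true] at c1 c2 c3
    simp only [← hAdef, ← hC] at *
    grind

/-- If `t^λ = t_0, t_1, …, t_K = t` is a chain of standard bitableaux of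
one-line shape `λ` with `t_j = s_{i_j}·t_{j-1}` and `t_{j-1} ≻ t_j` for all `j`, then the
word `s_{i_K} ⋯ s_{i_1}` is a reduced expression:  the Coxeter length of the permutation
`w = s_{i_K} ⋯ s_{i_1}` equals `K` (and `w·t^λ = t`).  The Coxeter length is expressed as
the least length of an expression of `w` as a product of adjacent transpositions. -/
theorem statement18 (n a b : ℕ) (hab : a + b = n) (S : Finset (Fin n)) (hS : S.card = a)
    (K : ℕ) (c : ℕ → Finset (Fin n)) (idx : ℕ → ℕ) (hidx : ∀ j < K, idx j + 1 < n)
    (h0 : c 0 = Slam n a b) (hK : c K = S)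
    (hstep : ∀ j (hj : j < K),
      c (j + 1) = (c j).image
        (Equiv.swap ⟨idx j, by have := hidx j hj; omega⟩ ⟨idx j + 1, hidx j hj⟩))
    (hdec : ∀ j < K, tabSucceq n (c j) (c (j + 1)) ∧ c j ≠ c (j + 1)) :
    ∀ w : Equiv.Perm (Fin n),
      w = ((List.ofFn fun j : Fin K =>
          (Equiv.swap (⟨idx j.val, by have := hidx j.val j.2; omega⟩ : Fin n)
            ⟨idx j.val + 1, hidx j.val j.2⟩ : Equiv.Perm (Fin n))).reverse).prod →
      (Slam n a b).image w = S ∧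
      IsLeast {len : ℕ | ∃ L : List (Equiv.Perm (Fin n)), L.length = len ∧
        (∀ τ ∈ L, ∃ (i : ℕ) (hi : i + 1 < n),
          τ = Equiv.swap ⟨i, by omega⟩ ⟨i + 1, hi⟩) ∧
        L.prod = w} K := by
  intro w hw
  have hval : ∀ j, ∃ σ : Equiv.Perm (Fin n), ∀ hj : j < K, σ = adjSwap (hidx j hj) := fun j => by
    by_cases hj : j < K
    · exact ⟨adjSwap (hidx j hj), fun _ => rfl⟩
    · exact ⟨1, fun h => absurd h hj⟩
  choose σ hσ using hval
  have hL : (List.ofFn fun j : Fin K =>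
      (Equiv.swap (⟨idx j.val, by have := hidx j.val j.2; omega⟩ : Fin n)
        ⟨idx j.val + 1, hidx j.val j.2⟩ : Equiv.Perm (Fin n))) = (List.range K).map σ := by
    refine List.ext_getElem (by simp) fun m h1 h2 => ?_
    have hm : m < K := by simpa using h1
    simp [hσ m hm, adjSwap]
  rw [hL] at hw
  have key : ∀ j ≤ K, ∃ v : Equiv.Perm (Fin n), v = ((List.range j).map σ).reverse.prod ∧
      (Slam n a b).image v = c j ∧ StrictMonoOn v (Slam n a b) ∧
      StrictMonoOn v ((Slam n a b)ᶜ : Finset (Fin n)) ∧ (inversions v).card = j := by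
    intro j
    induction j with
    | zero =>
      intro _
      refine ⟨1, by simp, by simp [h0], ?_, ?_, by simp [inversions_one]⟩ <;>
      exact fun _ _ _ _ h => h
    | succ j ih =>
      intro hj
      obtain ⟨v, hv, hc, hA, hB, hcard⟩ := ih (by omega)
      have hst : c (j + 1) = (c j).image (adjSwap (hidx j hj)) := hstep j hj
      obtain ⟨hsucc, hne⟩ := hdec j hj
      have hne' := fun h => hne (hst.trans (image_adjSwap_eq_self (hidx j hj) h)).symm
      rw [hst, ← hc] at hsucc
      rw [← hc] at hne'
      refine ⟨adjSwap (hidx j hj) * v, ?_, ?_, ?_, ?_, ?_⟩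
      · rw [List.range_succ, List.map_append, List.reverse_append, List.prod_append, ← hv]
        simp [hσ j hj]
      · rw [hst, ← hc, Finset.image_image]
        rfl
      · exact StrictMonoOn.adjSwap_mul _ hA (by tauto)
      · refine StrictMonoOn.adjSwap_mul _ hB ?_
        rw [image_compl_perm]
        simp only [Finset.mem_compl]
        tauto
      · rw [card_inversions_adjSwap_mul (hidx j hj) v (x := v.symm ⟨idx j, _⟩)
          (y := v.symm ⟨idx j + 1, hidx j hj⟩) (by simp) (by simp)
          (symm_lt_symm_of_tabSucceq hab (hidx j hj) hA hB hsucc hne'), hcard]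
  obtain ⟨v, hv, hc, -, -, hcard⟩ := key K le_rfl
  obtain rfl : v = w := hv.trans hw.symm
  refine ⟨hc.trans hK, ⟨_, by simp, ?_, hw.symm⟩, ?_⟩
  · intro τ hτ
    simp only [List.mem_reverse, List.mem_map, List.mem_range] at hτ
    obtain ⟨j, hj, rfl⟩ := hτ
    exact ⟨idx j, hidx j hj, hσ j hj⟩
  · rintro _ ⟨L, rfl, hL, hprod⟩
    rw [← hcard, ← hprod]
    exact card_inversions_prod_le L hL

end Statement18
end
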